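/- Let n ≥ 1 and m ≥ 0 be natural numbers and let G = D_{2^n(2m+1)} be the dihedral group of order 2^n(2m+1), with p = 2. Then ℓ_2(G,1) = 2 if n = 1, ℓ_2(G,1) = 3 if n = 2, and ℓ_2(G,1) = 2^{n−2} + 1 if n ≥ 3; and ext_2^1(G,1) = 1 if n = 1, ext_2^1(G,1) = 2 if n = 2, and ext_2^1(G,1) = 3 if n ≥ 3. -/

import Mathlib

open scoped TensorProduct Classical

/-! Common definitions: the character ring of a finite group, following Bonnafé,
"On the character ring of a finite group". -/

/-- The set of characters of finite-dimensional `K`-linear representations of `G`. -/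
def charSet (K G : Type u) [Field K] [Group G] : Set (G → K) :=
  {f | ∃ V : FDRep K G, f = FDRep.character V}

/-- The character ring `R(G)` of virtual characters, i.e. the subring of the `K`-algebra of
functions `G → K` generated by the characters.  Over a splitting field of characteristic zero
this is exactly the set of `ℤ`-linear combinations of irreducible characters. -/
def charRing (K G : Type u) [Field K] [Group G] : Subring (G → K) :=
  Subring.closure (charSet K G)

/-- `g` is `p`-regular if its order is prime to `p`. -/
def IsPRegular (p : ℕ) {G : Type*} [Monoid G] (g : G) : Prop :=
  Nat.Coprime (orderOf g) p

/-- `g` is a `p`-element if its order is a power of `p`. -/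
def IsPElement (p : ℕ) {G : Type*} [Monoid G] (g : G) : Prop :=
  ∃ n : ℕ, orderOf g = p ^ n

/-- The `p'`-part `g_{p'}` of an element `g` of a finite group:  writing `orderOf g = q * m'`
with `q` the `p`-part of the order, this is `g ^ (q * u)` where `u` is the inverse of
`q` modulo `m'`; it is the unique `p`-regular power of `g` such that `g * g_{p'}⁻¹` is a
`p`-element commuting with it. -/
noncomputable def pPrimePart (p : ℕ) {G : Type*} [Group G] (g : G) : G :=
  g ^ (p ^ (orderOf g).factorization p *
      (((p : ZMod (orderOf g / p ^ (orderOf g).factorization p)) ^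
        (orderOf g).factorization p)⁻¹).val)

/-- The `p'`-section `S_{p'}(C)` of the conjugacy class `C` of `g` : the set of all
`x ∈ G` whose `p'`-part lies in the class of `g`. -/
def pSection (p : ℕ) {G : Type*} [Group G] (g : G) : Set G :=
  {x | IsConj g (pPrimePart p x)}

/-- The idempotent class function `e_C` attached to the class `C` of `g`:  the characteristic
function (with values in `K`) of the `p'`-section of `C`. -/
noncomputable def eFun (p : ℕ) (K : Type*) [Field K] {G : Type*} [Group G] (g : G) : G → K :=
  fun x => if IsConj g (pPrimePart p x) then 1 else 0

/-- The number of conjugacy classes of `G` contained in a subset `S`. -/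
noncomputable def numClassesIn {G : Type*} [Group G] (S : Set G) : ℕ :=
  Nat.card {c : ConjClasses G // c.carrier ⊆ S}

/-- The image of the localization `𝒪_𝔭` in the fraction field `K`: fractions `a / b` with
`b ∉ 𝔭`. -/
def locSet (𝒪 K : Type*) [CommRing 𝒪] [Field K] [Algebra 𝒪 K] (𝔭 : Ideal 𝒪) : Set K :=
  {x | ∃ a b : 𝒪, b ∉ 𝔭 ∧ x * algebraMap 𝒪 K b = algebraMap 𝒪 K a}

/-- `𝒪_𝔭 R(G)`: the `𝒪_𝔭`-span of the character ring inside class functions `G → K`,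
realized as the subring generated by `𝒪_𝔭`-constants and characters. -/
def locCharRing (𝒪 : Type*) (K : Type u) [CommRing 𝒪] [Field K] [Algebra 𝒪 K] (𝔭 : Ideal 𝒪)
    (G : Type u) [Group G] : Subring (G → K) :=
  Subring.closure ({f | ∃ x ∈ locSet 𝒪 K 𝔭, f = Function.const G x} ∪ charSet K G)

/-- The ideal `𝔭 · 𝒪_𝔭R(G)` of `𝒪_𝔭R(G)`, generated by the constants from `𝔭`. -/
def pConstIdeal (𝒪 : Type*) (K : Type u) [CommRing 𝒪] [Field K] [Algebra 𝒪 K] (𝔭 : Ideal 𝒪)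
    (G : Type u) [Group G] : Ideal (locCharRing 𝒪 K 𝔭 G) :=
  Ideal.span {f | ∃ a ∈ 𝔭, (f : G → K) = Function.const G (algebraMap 𝒪 K a)}

/-- `kR(G) = k ⊗_ℤ R(G)`, realized through the canonical identification
`k ⊗_ℤ R(G) ≅ 𝒪_𝔭R(G) ⧸ 𝔭·𝒪_𝔭R(G)` (where `k = 𝒪/𝔭`). -/
abbrev kCharRing (𝒪 : Type*) (K : Type u) [CommRing 𝒪] [Field K] [Algebra 𝒪 K] (𝔭 : Ideal 𝒪)
    (G : Type u) [Group G] :=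
  locCharRing 𝒪 K 𝔭 G ⧸ pConstIdeal 𝒪 K 𝔭 G

/-- The ideal of `𝒪_𝔭R(G)` cutting out the block `R_𝔭(G, C)` with identity element the
idempotent `e : 𝒪_𝔭R(G)`, reduced mod `𝔭`:  the block `kR(G)·ē` is canonically the quotient
by `𝔭·𝒪_𝔭R(G) + (1 - e)·𝒪_𝔭R(G)`. -/
def blockIdeal (𝒪 : Type*) (K : Type u) [CommRing 𝒪] [Field K] [Algebra 𝒪 K] (𝔭 : Ideal 𝒪)
    (G : Type u) [Group G] (e : locCharRing 𝒪 K 𝔭 G) : Ideal (locCharRing 𝒪 K 𝔭 G) :=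
  pConstIdeal 𝒪 K 𝔭 G ⊔ Ideal.span {1 - e}

/-- The block `kR_𝔭(G, C) = kR(G)·ē_C` of `kR(G)`, as a (unital) `k`-algebra, realized as the
quotient of `𝒪_𝔭R(G)` by `𝔭·𝒪_𝔭R(G) + (1 - e_C)·𝒪_𝔭R(G)`. -/
abbrev blockAlg (𝒪 : Type*) (K : Type u) [CommRing 𝒪] [Field K] [Algebra 𝒪 K] (𝔭 : Ideal 𝒪)
    (G : Type u) [Group G] (e : locCharRing 𝒪 K 𝔭 G) :=
  locCharRing 𝒪 K 𝔭 G ⧸ blockIdeal 𝒪 K 𝔭 G e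

/-- The constants, as a ring morphism `𝒪 →+* 𝒪_𝔭R(G)`. -/
noncomputable def constRingHom (𝒪 : Type*) (K : Type u) [CommRing 𝒪] [Field K] [Algebra 𝒪 K]
    (𝔭 : Ideal 𝒪) [𝔭.IsMaximal] (G : Type u) [Group G] : 𝒪 →+* locCharRing 𝒪 K 𝔭 G where
  toFun a := ⟨Function.const G (algebraMap 𝒪 K a),
    Subring.subset_closure (Or.inl ⟨algebraMap 𝒪 K a,
      ⟨a, 1, fun h => (Ideal.ne_top_iff_one 𝔭).mp (Ideal.IsMaximal.ne_top ‹_›) h, by simp⟩, rfl⟩)⟩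
  map_one' := Subtype.ext (funext fun g => by simp)
  map_mul' a b := Subtype.ext (funext fun g => by simp)
  map_zero' := Subtype.ext (funext fun g => by simp)
  map_add' a b := Subtype.ext (funext fun g => by simp)

/-- The structural morphism giving quotients of `𝒪_𝔭R(G)` by ideals containing
`𝔭·𝒪_𝔭R(G)` (such as `kR(G)` and its blocks) their `k = 𝒪/𝔭`-algebra structure. -/
noncomputable def kScalars (𝒪 : Type*) (K : Type u) [CommRing 𝒪] [Field K] [Algebra 𝒪 K]
    (𝔭 : Ideal 𝒪) [𝔭.IsMaximal] (G : Type u) [Group G]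
    (I : Ideal (locCharRing 𝒪 K 𝔭 G)) (hI : pConstIdeal 𝒪 K 𝔭 G ≤ I) :
    (𝒪 ⧸ 𝔭) →+* (locCharRing 𝒪 K 𝔭 G ⧸ I) :=
  Ideal.Quotient.lift 𝔭 ((Ideal.Quotient.mk I).comp (constRingHom 𝒪 K 𝔭 G))
    (fun a ha => by
      simp only [RingHom.comp_apply]
      exact Ideal.Quotient.eq_zero_iff_mem.mpr (hI (Ideal.subset_span ⟨a, ha, rfl⟩)))

/-- The `k`-algebra structure morphism of the block `kR_𝔭(G, C)`. -/
noncomputable def blockScalars (𝒪 : Type*) (K : Type u) [CommRing 𝒪] [Field K] [Algebra 𝒪 K]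
    (𝔭 : Ideal 𝒪) [𝔭.IsMaximal] (G : Type u) [Group G] (e : locCharRing 𝒪 K 𝔭 G) :
    (𝒪 ⧸ 𝔭) →+* blockAlg 𝒪 K 𝔭 G e :=
  kScalars 𝒪 K 𝔭 G (blockIdeal 𝒪 K 𝔭 G e) le_sup_left

/-- The Jacobson radical of a ring. -/
noncomputable def jacRad (A : Type*) [CommRing A] : Ideal A := (⊥ : Ideal A).jacobson

/-- The Loewy length of `A`: the least `n` with `(Rad A) ^ n = 0`. -/
noncomputable def loewyLength (A : Type*) [CommRing A] : ℕ :=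
  sInf {n : ℕ | jacRad A ^ n = ⊥}

/-- `Rad A / (Rad A)²`. -/
noncomputable abbrev radQuotient (A : Type*) [CommRing A] :=
  jacRad A ⧸ (Submodule.comap (jacRad A).subtype (jacRad A ^ 2 : Ideal A))

/-- `dim_k Rad(A)/Rad(A)²`, the `k`-vector space structure being induced by a ring morphism
`k →+* A`. -/
noncomputable def extDim (k : Type*) [CommRing k] {A : Type*} [CommRing A] (φ : k →+* A) : ℕ :=
  letI : Module k (radQuotient A) := Module.compHom _ φ
  Module.finrank k (radQuotient A)

/-- `dim_k A`, the `k`-vector space structure being induced by a ring morphism `k →+* A`. -/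
noncomputable def kDim (k : Type*) [CommRing k] {A : Type*} [CommRing A] (φ : k →+* A) : ℕ :=
  letI : Module k A := Module.compHom _ φ
  Module.finrank k A

/-- `dim_k I` for an ideal `I` of `A`, the `k`-vector space structure being induced by a ring
morphism `k →+* A`. -/
noncomputable def idealKDim (k : Type*) [CommRing k] {A : Type*} [CommRing A] (φ : k →+* A)
    (I : Ideal A) : ℕ :=
  letI : Module k I := Module.compHom _ φ
  Module.finrank k I

theorem jacRad_eq_of_isNilpotent {k A : Type*} [Field k] [CommRing A] [Nontrivial A] [Algebra k A]
    {I : Ideal A} (hI : IsNilpotent I) (h : ∀ y, ∃ c : k, y - algebraMap k A c ∈ I) :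
    jacRad A = I := by
  obtain ⟨n, hn⟩ := hI
  have htop : I ≠ ⊤ := by
    rintro rfl
    rw [Ideal.top_pow] at hn
    exact top_ne_bot hn
  have hmax : I.IsMaximal := by
    rw [Ideal.isMaximal_iff]
    refine ⟨fun h1 => htop ((Ideal.eq_top_iff_one I).mpr h1), fun J x hIJ hxI hxJ => ?_⟩
    obtain ⟨c, hc⟩ := h x
    have hc0 : c ≠ 0 := by
      rintro rfl
      simp only [map_zero, sub_zero] at hc
      exact hxI hc
    have hcJ : algebraMap k A c ∈ J := by
      have := J.sub_mem hxJ (hIJ hc)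
      rwa [sub_sub_cancel] at this
    have := J.mul_mem_left (algebraMap k A c⁻¹) hcJ
    rwa [← map_mul, inv_mul_cancel₀ hc0, map_one] at this
  refine le_antisymm (sInf_le ⟨bot_le, hmax⟩) (le_sInf fun J hJ => ?_)
  have := hJ.2.isPrime
  exact (Ideal.IsPrime.le_of_pow_le (n := n)) (by rw [hn]; exact bot_le)

theorem loewyLength_eq {A : Type*} [CommRing A] {d : ℕ} (h1 : jacRad A ^ (d + 1) = ⊥)
    (h2 : jacRad A ^ d ≠ ⊥) : loewyLength A = d + 1 := by
  refine le_antisymm (Nat.sInf_le h1) (le_csInf ⟨_, h1⟩ fun j hj => ?_)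
  by_contra! hlt
  exact h2 (le_bot_iff.mp ((Ideal.pow_le_pow_right (by omega : j ≤ d)).trans (le_of_eq hj)))

theorem extDim_eq {k A : Type*} [Field k] [CommRing A] (φ : k →+* A) {d : ℕ} (w : Fin d → A)
    (hw : ∀ i, w i ∈ jacRad A)
    (hspan : ∀ y ∈ jacRad A, ∃ c : Fin d → k, y - ∑ i, φ (c i) * w i ∈ jacRad A ^ 2)
    (hli : ∀ c : Fin d → k, ∑ i, φ (c i) * w i ∈ jacRad A ^ 2 → ∀ i, c i = 0) :
    extDim k φ = d := by
  unfold extDim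
  let : Module k (radQuotient A) := Module.compHom _ φ
  let S : Submodule A (jacRad A) :=
    Submodule.comap (jacRad A).subtype (jacRad A ^ 2 : Ideal A)
  let u : Fin d → radQuotient A := fun i => S.mkQ ⟨w i, hw i⟩
  have hsum : ∀ c : Fin d → k, ∑ i, c i • u i = S.mkQ (∑ i, φ (c i) • ⟨w i, hw i⟩) := by
    intro c
    rw [map_sum]
    refine Finset.sum_congr rfl fun i _ => ?_
    rw [map_smul]
    rfl
  have hval : ∀ c : Fin d → k,
      ((∑ i, φ (c i) • (⟨w i, hw i⟩ : jacRad A) : jacRad A) : A) = ∑ i, φ (c i) * w i := by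
    intro c
    simp
  have li : LinearIndependent k u := by
    rw [Fintype.linearIndependent_iff]
    intro c hc
    apply hli c
    rw [hsum] at hc
    have := (Submodule.Quotient.mk_eq_zero S).mp hc
    rw [← hval]
    exact this
  have sp : ⊤ ≤ Submodule.span k (Set.range u) := by
    rintro y -
    obtain ⟨y, rfl⟩ := S.mkQ_surjective y
    obtain ⟨c, hc⟩ := hspan y y.2
    have : S.mkQ y = ∑ i, c i • u i := by
      rw [hsum]
      refine (Submodule.Quotient.eq S).mpr ?_
      change ((y - _ : jacRad A) : A) ∈ jacRad A ^ 2
      rw [AddSubgroupClass.coe_sub, hval]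
      exact hc
    rw [this]
    exact Submodule.sum_mem _ fun i _ =>
      Submodule.smul_mem _ _ (Submodule.subset_span ⟨i, rfl⟩)
  simpa using Module.finrank_eq_card_basis (Module.Basis.mk li sp)

theorem involution_algebra_invariants {k A : Type*} [Field k] [CommRing A] [Algebra k A]
    (h2 : (2 : A) = 0) {a : A} (ha : a * a = 1)
    (li : LinearIndependent k ![1, a]) (sp : ⊤ ≤ Submodule.span k (Set.range ![1, a])) :
    loewyLength A = 2 ∧ extDim k (algebraMap k A) = 1 := by
  have hli : ∀ s t : k, algebraMap k A s + algebraMap k A t * a = 0 → s = 0 ∧ t = 0 := by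
    intro s t h
    refine LinearIndependent.pair_iff.mp li s t ?_
    simpa [Algebra.smul_def] using h
  have hsp : ∀ y : A, ∃ s t : k, y = algebraMap k A s + algebraMap k A t * a := by
    intro y
    have := sp (Submodule.mem_top (x := y))
    rw [Matrix.range_cons, Matrix.range_cons, Matrix.range_empty, Set.union_empty,
      Set.singleton_union, Submodule.mem_span_pair] at this
    obtain ⟨s, t, h⟩ := this
    exact ⟨s, t, by simpa [Algebra.smul_def] using h.symm⟩
  have : Nontrivial A := ⟨1, 0, fun h => one_ne_zero (hli 1 0 (by simpa using h)).1⟩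
  have hα : (1 + a) * (1 + a) = 0 := by linear_combination ha + (1 + a) * h2
  have hsq : Ideal.span {1 + a} ^ 2 = ⊥ := by
    rw [Ideal.span_singleton_pow, sq, hα, Ideal.span_singleton_eq_bot]
  have hα0 : 1 + a ≠ 0 := fun h => one_ne_zero (hli 1 1 (by simpa using h)).1
  have hjac : jacRad A = Ideal.span {1 + a} := by
    refine jacRad_eq_of_isNilpotent (k := k) ⟨2, hsq⟩ fun y => ?_
    obtain ⟨s, t, rfl⟩ := hsp y
    refine ⟨s + t, Ideal.mem_span_singleton'.mpr ⟨algebraMap k A t, ?_⟩⟩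
    rw [map_add]
    linear_combination algebraMap k A t * h2
  refine ⟨loewyLength_eq (d := 1) (by rw [hjac, hsq]) ?_,
    extDim_eq _ ![1 + a] ?_ ?_ ?_⟩
  · rw [hjac, pow_one, Ne, Ideal.span_singleton_eq_bot]
    exact hα0
  · intro i
    fin_cases i
    simp [hjac]
  · intro y hy
    rw [hjac, Ideal.mem_span_singleton'] at hy
    obtain ⟨z, rfl⟩ := hy
    obtain ⟨s, t, rfl⟩ := hsp z
    refine ⟨fun _ => s + t, ?_⟩
    rw [hjac, hsq, Ideal.mem_bot]
    simp only [Finset.univ_unique, Fin.default_eq_zero, Finset.sum_singleton, map_add,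
      Matrix.cons_val_zero]
    linear_combination algebraMap k A t * ha
  · intro c hc i
    rw [hjac, hsq, Ideal.mem_bot] at hc
    simp only [Finset.univ_unique, Fin.default_eq_zero, Finset.sum_singleton,
      Matrix.cons_val_zero] at hc
    fin_cases i
    exact (hli (c 0) (c 0) (by linear_combination hc)).1

theorem klein_four_algebra_invariants {k A : Type*} [Field k] [CommRing A] [Algebra k A]
    (h2 : (2 : A) = 0) {a b : A} (ha : a * a = 1) (hb : b * b = 1)
    (li : LinearIndependent k ![1, a, b, a * b])
    (sp : ⊤ ≤ Submodule.span k (Set.range ![1, a, b, a * b])) :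
    loewyLength A = 3 ∧ extDim k (algebraMap k A) = 2 := by
  have hli : ∀ s t u v : k, algebraMap k A s + algebraMap k A t * a + algebraMap k A u * b +
      algebraMap k A v * (a * b) = 0 → s = 0 ∧ t = 0 ∧ u = 0 ∧ v = 0 := by
    intro s t u v h
    have := Fintype.linearIndependent_iff.mp li ![s, t, u, v]
      (by simpa [Fin.sum_univ_four, Algebra.smul_def] using h)
    exact ⟨this 0, this 1, this 2, this 3⟩
  have hsp : ∀ y : A, ∃ s t u v : k, y = algebraMap k A s + algebraMap k A t * a +
      algebraMap k A u * b + algebraMap k A v * (a * b) := by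
    intro y
    obtain ⟨c, hc⟩ := (Submodule.mem_span_range_iff_exists_fun k).mp
      (sp (Submodule.mem_top (x := y)))
    exact ⟨c 0, c 1, c 2, c 3, by simpa [Fin.sum_univ_four, Algebra.smul_def] using hc.symm⟩
  have : Nontrivial A := ⟨1, 0, fun h => one_ne_zero (hli 1 0 0 0 (by simpa using h)).1⟩
  have hα : (1 + a) * (1 + a) = 0 := by linear_combination ha + (1 + a) * h2
  have hβ : (1 + b) * (1 + b) = 0 := by linear_combination hb + (1 + b) * h2
  have hαβ : (1 + a) * (1 + b) ≠ 0 := fun h =>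
    one_ne_zero (hli 1 1 1 1 (by simp only [map_one]; linear_combination h)).1
  have hsq : Ideal.span {1 + a, 1 + b} ^ 2 = Ideal.span {(1 + a) * (1 + b)} := by
    rw [sq, Ideal.span_mul_span']
    refine le_antisymm (Ideal.span_le.mpr ?_) (Ideal.span_le.mpr ?_)
    · rintro _ ⟨x, hx, y, hy, rfl⟩
      rcases hx with rfl | rfl <;> rcases hy with rfl | rfl <;> dsimp only
      · rw [hα]; exact zero_mem _
      · exact Ideal.mem_span_singleton_self _
      · rw [mul_comm]; exact Ideal.mem_span_singleton_self _
      · rw [hβ]; exact zero_mem _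
    · rintro _ rfl
      exact Ideal.subset_span ⟨_, Or.inl rfl, _, Or.inr rfl, rfl⟩
  have hcube : Ideal.span {1 + a, 1 + b} ^ 3 = ⊥ := by
    rw [pow_succ, hsq, Ideal.span_mul_span', Ideal.span_eq_bot]
    rintro _ ⟨x, rfl, y, hy, rfl⟩
    rcases hy with rfl | rfl <;> dsimp only
    · linear_combination (1 + b) * hα
    · linear_combination (1 + a) * hβ
  have key : ∀ s t u v : k, algebraMap k A s + algebraMap k A t * a +
      algebraMap k A u * b + algebraMap k A v * (a * b) = algebraMap k A (s + t + u + v) +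
      algebraMap k A (t + v) * (1 + a) + algebraMap k A (u + v) * (1 + b) +
      algebraMap k A v * ((1 + a) * (1 + b)) := by
    intro s t u v
    simp only [map_add]
    linear_combination -(algebraMap k A t + algebraMap k A u + 2 * algebraMap k A v +
      algebraMap k A v * a + algebraMap k A v * b) * h2
  have ha' : 1 + a ∈ Ideal.span {1 + a, 1 + b} := Ideal.subset_span (Or.inl rfl)
  have hb' : 1 + b ∈ Ideal.span {1 + a, 1 + b} := Ideal.subset_span (Or.inr rfl)
  have hjac : jacRad A = Ideal.span {1 + a, 1 + b} := by
    refine jacRad_eq_of_isNilpotent (k := k) ⟨3, hcube⟩ fun y => ?_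
    obtain ⟨s, t, u, v, rfl⟩ := hsp y
    refine ⟨s + t + u + v, ?_⟩
    rw [key, add_assoc, add_assoc, add_sub_cancel_left]
    exact add_mem (Ideal.mul_mem_left _ _ ha')
      (add_mem (Ideal.mul_mem_left _ _ hb') (Ideal.mul_mem_left _ _ (Ideal.mul_mem_left _ _ hb')))
  refine ⟨loewyLength_eq (d := 2) (by rw [hjac, hcube]) ?_,
    extDim_eq _ ![1 + a, 1 + b] ?_ ?_ ?_⟩
  · rw [hjac, hsq, Ne, Ideal.span_singleton_eq_bot]
    exact hαβ
  · intro i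
    rw [hjac]
    fin_cases i
    · exact ha'
    · exact hb'
  · intro y hy
    rw [hjac] at hy ⊢
    obtain ⟨c, d, rfl⟩ := Ideal.mem_span_pair.mp hy
    obtain ⟨s, t, u, v, rfl⟩ := hsp c
    obtain ⟨s', t', u', v', rfl⟩ := hsp d
    refine ⟨![s + t + u + v, s' + t' + u' + v'], ?_⟩
    rw [hsq, key s, key s', Fin.sum_univ_two]
    refine Ideal.mem_span_singleton'.mpr ⟨algebraMap k A (u + v) + algebraMap k A (t' + v'), ?_⟩
    simp only [Matrix.cons_val_zero, Matrix.cons_val_one]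
    linear_combination (-algebraMap k A (t + v) - algebraMap k A v * (1 + b)) * hα -
      (algebraMap k A (u' + v') + algebraMap k A v' * (1 + a)) * hβ
  · intro c hc
    rw [hjac, hsq, Fin.sum_univ_two] at hc
    simp only [Matrix.cons_val_zero, Matrix.cons_val_one] at hc
    obtain ⟨z, hz⟩ := Ideal.mem_span_singleton'.mp hc
    obtain ⟨s, t, u, v, rfl⟩ := hsp z
    have h0 : algebraMap k A (s + t + u + v) * ((1 + a) * (1 + b)) =
        algebraMap k A (c 0) * (1 + a) + algebraMap k A (c 1) * (1 + b) := by
      rw [← hz, key]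
      linear_combination (-algebraMap k A (t + v) * (1 + b)
        - algebraMap k A v * ((1 + b) * (1 + b))) * hα -
        algebraMap k A (u + v) * (1 + a) * hβ
    set e := s + t + u + v
    obtain ⟨-, h1, h2', h3⟩ := hli (e - c 0 - c 1) (e - c 0) (e - c 1) e (by
      simp only [map_sub]
      linear_combination h0)
    rw [h3, zero_sub, neg_eq_zero] at h1 h2'
    intro i
    fin_cases i
    · exact h1
    · exact h2'

/-- The `k`-span of the powers `x ^ i` with `i ≥ j`. -/
def powSpan (k : Type*) {A : Type*} [CommRing k] [CommRing A] [Algebra k A] (x : A) (j : ℕ) :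
    Submodule k A :=
  Submodule.span k (Set.range fun i : ℕ => x ^ (i + j))

section powSpan

variable {k A : Type*} [CommRing k] [CommRing A] [Algebra k A] {x : A}

theorem pow_mem_powSpan {i j : ℕ} (h : j ≤ i) : x ^ i ∈ powSpan k x j :=
  Submodule.subset_span ⟨i - j, by simp [Nat.sub_add_cancel h]⟩

theorem powSpan_le_iff {j : ℕ} {W : Submodule k A} :
    powSpan k x j ≤ W ↔ ∀ i, j ≤ i → x ^ i ∈ W := by
  refine ⟨fun h i hi => h (pow_mem_powSpan hi), fun h => Submodule.span_le.mpr ?_⟩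
  rintro _ ⟨i, rfl⟩
  exact h _ (Nat.le_add_left _ _)

theorem powSpan_anti {i j : ℕ} (h : i ≤ j) : powSpan k x j ≤ powSpan k x i :=
  powSpan_le_iff.mpr fun _ hl => pow_mem_powSpan (h.trans hl)

theorem pow_mul_mem_powSpan (h : ℕ) {j : ℕ} {y : A} (hy : y ∈ powSpan k x j) :
    x ^ h * y ∈ powSpan k x (h + j) := by
  have : powSpan k x j ≤ (powSpan k x (h + j)).comap (LinearMap.mulLeft k (x ^ h)) :=
    powSpan_le_iff.mpr fun i hi => by
      simp only [Submodule.mem_comap, LinearMap.mulLeft_apply, ← pow_add]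
      exact pow_mem_powSpan (by omega)
  exact this hy

theorem powSpan_le_ideal {j : ℕ} {y : A} (hy : y ∈ powSpan k x j) : y ∈ Ideal.span {x ^ j} := by
  have : powSpan k x j ≤ (Ideal.span {x ^ j}).restrictScalars k :=
    powSpan_le_iff.mpr fun i hi =>
      Ideal.mem_span_singleton.mpr (pow_dvd_pow x hi)
  exact this hy

end powSpan

theorem dihedral_algebra_invariants {k A : Type*} [Field k] [CommRing A] [Algebra k A]
    (h2 : (2 : A) = 0) {M l : ℕ} (hM : M = 2 ^ (l + 1)) {a b : A} {χ : ℤ → A}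
    (hb : b * b = 1) (hmul : ∀ i j, χ i * χ j = χ (i + j) + χ (i - j))
    (hneg : ∀ i, χ (-i) = χ i) (h0 : χ 0 = 1 + a) (haχ : ∀ i, a * χ i = χ i)
    (hbχ : ∀ i, b * χ i = χ (i + M))
    (li : LinearIndependent k
      (Sum.elim ![1, a, b, a * b] fun i : Fin (M - 1) => χ ((i : ℕ) + 1)))
    (sp : ⊤ ≤ Submodule.span k
      (Set.range (Sum.elim ![1, a, b, a * b] fun i : Fin (M - 1) => χ ((i : ℕ) + 1)))) :
    loewyLength A = M + 1 ∧ extDim k (algebraMap k A) = 3 := by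
  have hM2 : 2 ≤ M := by
    rw [hM, pow_succ]
    have := Nat.one_le_two_pow (n := l)
    omega
  set α := 1 + a with hα
  set β := 1 + b with hβ
  set x := χ 1 with hx
  have hαχ : ∀ i, α * χ i = 0 := fun i => by
    rw [hα]; linear_combination haχ i + χ i * h2
  have hαα : α * α = 0 := by
    have := hαχ 0
    rwa [h0] at this
  have hββ : β * β = 0 := by rw [hβ]; linear_combination hb + (1 + b) * h2
  have hpow : ∀ j : ℕ, x ^ 2 ^ (j + 1) = χ (2 ^ (j + 1)) + α := by
    intro j
    induction j with
    | zero =>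
      have := hmul 1 1
      norm_num at this
      rw [h0] at this
      simp only [zero_add, pow_one]
      linear_combination this
    | succ j ih =>
      have := hmul (2 ^ (j + 1)) (2 ^ (j + 1))
      rw [sub_self, h0, ← two_mul, ← pow_succ'] at this
      rw [pow_succ 2 (j + 1), pow_mul, ih]
      linear_combination this + 2 * hαχ (2 ^ (j + 1)) + hαα
  have hxM : x ^ M = α * β := by
    have h1 := hpow l
    rw [← hM] at h1
    have h3 := hbχ 0
    rw [h0, zero_add, hM] at h3
    push_cast at h3
    rw [h1, ← h3, hβ]
    ring
  have hxα : x * α = 0 := by rw [mul_comm]; exact hαχ 1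
  have hxM1 : ∀ i, M < i → x ^ i = 0 := by
    intro i hi
    obtain ⟨j, rfl⟩ := Nat.exists_eq_add_of_lt hi
    rw [show M + j + 1 = j + (M + 1) by ring, pow_add, pow_succ x M, hxM]
    linear_combination x ^ j * β * hxα
  let W : Submodule k A := Submodule.span k {α} ⊔ powSpan k x 1
  have hαW : α ∈ W := (le_sup_left : _ ≤ W) (Submodule.mem_span_singleton_self α)
  have hpW : ∀ {y}, y ∈ powSpan k x 1 → y ∈ W := fun h => (le_sup_right : _ ≤ W) h
  have hxW : ∀ (h : ℕ) {y : A}, 1 ≤ h → y ∈ W → x ^ h * y ∈ powSpan k x (h + 1) := by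
    intro h y hh hy
    obtain ⟨u, hu, v, hv, rfl⟩ := Submodule.mem_sup.mp hy
    obtain ⟨c, rfl⟩ := Submodule.mem_span_singleton.mp hu
    obtain ⟨h, rfl⟩ := Nat.exists_eq_add_of_le' hh
    have : x ^ (h + 1) * c • α = 0 := by
      rw [mul_smul_comm, pow_succ, mul_assoc, hxα, mul_zero, smul_zero]
    rw [mul_add, this, zero_add]
    exact pow_mul_mem_powSpan _ hv
  have hχW : ∀ j : ℕ, χ j ∈ W := by
    intro j
    induction j using Nat.strong_induction_on with
    | _ j ih =>
      match j, ih with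
      | 0, _ => simpa [h0] using hαW
      | 1, _ =>
        have := pow_mem_powSpan (k := k) (x := x) (le_refl 1)
        rw [pow_one] at this
        simpa using hpW this
      | j + 2, ih =>
        have h1 := hmul (j + 1) 1
        have h3 := hxW 1 le_rfl (ih (j + 1) (by omega))
        have h4 := W.sub_mem (hpW (powSpan_anti (by norm_num) h3)) (ih j (by omega))
        convert h4 using 1
        push_cast
        rw [add_sub_cancel_right, show (j : ℤ) + 1 + 1 = j + 2 by ring] at h1
        linear_combination -h1
  have hxβ : x * β ∈ powSpan k x 2 := by
    have h1 : x * β = χ (2 ^ l : ℕ) * χ (2 ^ l + 1 : ℕ) := by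
      rw [hmul]
      push_cast
      rw [show (2 : ℤ) ^ l + (2 ^ l + 1) = 1 + M by rw [hM]; push_cast; ring,
        show (2 : ℤ) ^ l - (2 ^ l + 1) = -1 by ring, hneg, ← hbχ, hβ]
      ring
    rw [h1]
    obtain rfl | ⟨j, rfl⟩ : l = 0 ∨ ∃ j, l = j + 1 := by
      cases l
      · exact Or.inl rfl
      · exact Or.inr ⟨_, rfl⟩
    · simpa using hxW 1 le_rfl (hχW 2)
    · have h3 : χ (2 ^ (j + 1) : ℕ) * χ (2 ^ (j + 1) + 1 : ℕ) =
          x ^ 2 ^ (j + 1) * χ (2 ^ (j + 1) + 1 : ℕ) := by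
        rw [hpow]
        push_cast
        linear_combination -hαχ (2 ^ (j + 1) + 1)
      rw [h3]
      refine powSpan_anti ?_ (hxW _ Nat.one_le_two_pow (hχW _))
      have := Nat.one_le_two_pow (n := j + 1)
      omega
  -- the basis adapted to the radical filtration
  let v : Fin 3 ⊕ Fin M → A := Sum.elim ![1, α, β] fun i => x ^ ((i : ℕ) + 1)
  have hv1 : (1 : A) ∈ Submodule.span k (Set.range v) := Submodule.subset_span ⟨Sum.inl 0, rfl⟩
  have hvα : α ∈ Submodule.span k (Set.range v) := Submodule.subset_span ⟨Sum.inl 1, rfl⟩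
  have hvβ : β ∈ Submodule.span k (Set.range v) := Submodule.subset_span ⟨Sum.inl 2, rfl⟩
  have hvp : powSpan k x 1 ≤ Submodule.span k (Set.range v) := by
    refine powSpan_le_iff.mpr fun i hi => ?_
    by_cases h : i ≤ M
    · refine Submodule.subset_span ⟨Sum.inr ⟨i - 1, by omega⟩, ?_⟩
      simp [v, Nat.sub_add_cancel hi]
    · rw [hxM1 i (by omega)]
      exact zero_mem _
  have hvW : W ≤ Submodule.span k (Set.range v) :=
    sup_le (Submodule.span_le.mpr (by rintro _ rfl; exact hvα)) hvp
  have hvsp : ⊤ ≤ Submodule.span k (Set.range v) := by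
    refine sp.trans (Submodule.span_le.mpr ?_)
    have ha' : a = α - 1 := by rw [hα]; ring
    have hb' : b = β - 1 := by rw [hβ]; ring
    have hab : a * b = x ^ M - α - β + 1 := by rw [hxM, hα, hβ]; ring
    rintro _ ⟨i | i, rfl⟩
    · fin_cases i
      · exact hv1
      · change a ∈ _
        rw [ha']
        exact sub_mem hvα hv1
      · change b ∈ _
        rw [hb']
        exact sub_mem hvβ hv1
      · change a * b ∈ _
        rw [hab]
        exact add_mem (sub_mem (sub_mem (hvp (pow_mem_powSpan (by omega))) hvα) hvβ) hv1
    · have := hvW (hχW ((i : ℕ) + 1))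
      simpa using this
  have hvli : LinearIndependent k v := by
    refine linearIndependent_of_top_le_span_of_card_eq_finrank hvsp ?_
    rw [Module.finrank_eq_card_basis (Module.Basis.mk li sp)]
    simp only [Fintype.card_sum, Fintype.card_fin]
    omega
  let B := Module.Basis.mk hvli hvsp
  have hB : ∀ i, B i = v i := fun i => Module.Basis.mk_apply hvli hvsp i
  have hcoord : ∀ i, (∀ j : Fin M, 1 ≤ (j : ℕ) → i ≠ Sum.inr j) → ∀ y ∈ powSpan k x 2,
      B.coord i y = 0 := by
    intro i hi y hy
    have : powSpan k x 2 ≤ LinearMap.ker (B.coord i) := by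
      refine powSpan_le_iff.mpr fun j hj => ?_
      rw [LinearMap.mem_ker]
      by_cases h : j ≤ M
      · have h3 : x ^ j = B (Sum.inr ⟨j - 1, by omega⟩) := by
          rw [hB]
          simp only [v, Sum.elim_inr]
          rw [Nat.sub_add_cancel (by omega)]
        rw [h3, Module.Basis.coord_apply, Module.Basis.repr_self, Finsupp.single_apply, if_neg]
        exact fun h' => hi ⟨j - 1, by omega⟩ (by simp only; omega) h'.symm
      · rw [hxM1 j (by omega), map_zero]
    exact this hy
  have hdecomp : ∀ y : A, ∃ s t u w : k, ∃ z ∈ powSpan k x 2, y = algebraMap k A s +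
      algebraMap k A t * α + algebraMap k A u * β + algebraMap k A w * x + z := by
    intro y
    obtain ⟨c, rfl⟩ := (Submodule.mem_span_range_iff_exists_fun k).mp
      (hvsp (Submodule.mem_top (x := y)))
    obtain ⟨M, rfl⟩ := Nat.exists_eq_add_of_le' (show 1 ≤ M by omega)
    refine ⟨c (Sum.inl 0), c (Sum.inl 1), c (Sum.inl 2), c (Sum.inr 0),
      ∑ i : Fin M, c (Sum.inr i.succ) • x ^ ((i : ℕ) + 2), Submodule.sum_mem _ fun i _ =>
        Submodule.smul_mem _ _ (pow_mem_powSpan (by omega)), ?_⟩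
    rw [Fintype.sum_sum_type, Fin.sum_univ_three, Fin.sum_univ_succ]
    simp [v, Algebra.smul_def]
    ring
  have : Nontrivial A := ⟨1, 0, by
    have := hvli.ne_zero (Sum.inl 0)
    exact this⟩
  have hxM0 : x ^ M ≠ 0 := by
    have := hvli.ne_zero (Sum.inr ⟨M - 1, by omega⟩)
    simpa only [v, Sum.elim_inr, Nat.sub_add_cancel (show 1 ≤ M by omega)] using this
  set I : Ideal A := Ideal.span {α, β, x} with hI
  have hαI : α ∈ I := Ideal.subset_span (by simp)
  have hβI : β ∈ I := Ideal.subset_span (by simp)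
  have hxI : x ∈ I := Ideal.subset_span (by simp)
  have hx2I : ∀ {y}, y ∈ powSpan k x 2 → y ∈ I := fun hy =>
    (Ideal.span_singleton_le_iff_mem I).mpr (I.mul_mem_left x hxI)
      (by have := powSpan_le_ideal hy; rwa [sq] at this)
  have hsq : I ^ 2 = Ideal.span {x ^ 2} := by
    rw [hI, sq, Ideal.span_mul_span']
    refine le_antisymm (Ideal.span_le.mpr ?_) (Ideal.span_le.mpr ?_)
    · have hαβ : α * β ∈ Ideal.span {x ^ 2} := by
        rw [← hxM]
        exact Ideal.mem_span_singleton.mpr (pow_dvd_pow x hM2)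
      have hxβ' := powSpan_le_ideal hxβ
      rintro _ ⟨y, hy, z, hz, rfl⟩
      rcases hy with rfl | rfl | rfl <;> rcases hz with rfl | rfl | rfl <;> dsimp only
      · rw [hαα]; exact zero_mem _
      · exact hαβ
      · rw [mul_comm, hxα]; exact zero_mem _
      · rw [mul_comm]; exact hαβ
      · rw [hββ]; exact zero_mem _
      · rw [mul_comm]; exact hxβ'
      · rw [hxα]; exact zero_mem _
      · exact hxβ'
      · rw [← sq]; exact Ideal.mem_span_singleton_self _
    · rintro _ rfl
      exact Ideal.subset_span ⟨x, by simp, x, by simp, by ring⟩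
  have hIpow : ∀ j, I ^ (j + 2) = Ideal.span {x ^ (j + 2)} := by
    intro j
    induction j with
    | zero => exact hsq
    | succ j ih =>
      rw [show j + 1 + 2 = (j + 2) + 1 by ring, pow_succ, ih, hI, Ideal.span_mul_span']
      refine le_antisymm (Ideal.span_le.mpr ?_) (Ideal.span_le.mpr ?_)
      · rintro _ ⟨y, rfl, z, hz, rfl⟩
        rcases hz with rfl | rfl | rfl <;> dsimp only
        · rw [show x ^ (j + 2) * α = 0 by linear_combination x ^ (j + 1) * hxα]
          exact zero_mem _
        · obtain ⟨w, hw⟩ := Ideal.mem_span_singleton.mp (powSpan_le_ideal hxβ)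
          exact Ideal.mem_span_singleton.mpr ⟨w, by linear_combination x ^ (j + 1) * hw⟩
        · exact Ideal.mem_span_singleton.mpr (by rw [pow_succ])
      · rintro _ rfl
        exact Ideal.subset_span ⟨_, rfl, x, by simp, by ring⟩
  have hIM : I ^ M = Ideal.span {x ^ M} := by
    obtain ⟨j, hj⟩ := Nat.exists_eq_add_of_le' hM2
    rw [hj, hIpow]
  have hIM1 : I ^ (M + 1) = ⊥ := by
    obtain ⟨j, hj⟩ := Nat.exists_eq_add_of_le' (show 2 ≤ M + 1 by omega)
    rw [hj, hIpow, ← hj, hxM1 _ (by omega), Ideal.span_singleton_eq_bot]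
  have hjac : jacRad A = I := by
    refine jacRad_eq_of_isNilpotent (k := k) ⟨_, hIM1⟩ fun y => ?_
    obtain ⟨s, t, u, w, z, hz, rfl⟩ := hdecomp y
    refine ⟨s, ?_⟩
    rw [add_assoc, add_assoc, add_assoc, add_sub_cancel_left]
    exact add_mem (Ideal.mul_mem_left _ _ hαI) (add_mem (Ideal.mul_mem_left _ _ hβI)
      (add_mem (Ideal.mul_mem_left _ _ hxI) (hx2I hz)))
  have hx2 : ∀ y ∈ Ideal.span {x ^ 2}, y ∈ powSpan k x 2 := by
    intro y hy
    obtain ⟨y, rfl⟩ := Ideal.mem_span_singleton.mp hy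
    obtain ⟨s, t, u, w, z, hz, rfl⟩ := hdecomp y
    have e : x ^ 2 * (algebraMap k A s + algebraMap k A t * α + algebraMap k A u * β +
        algebraMap k A w * x + z) = s • x ^ 2 + u • (x ^ 1 * (x * β)) + w • x ^ 3 + x ^ 2 * z := by
      simp only [Algebra.smul_def]
      linear_combination algebraMap k A t * x * hxα
    rw [e]
    refine add_mem (add_mem (add_mem ?_ ?_) ?_) ?_
    · exact Submodule.smul_mem _ _ (pow_mem_powSpan le_rfl)
    · exact Submodule.smul_mem _ _ (powSpan_anti (by norm_num) (pow_mul_mem_powSpan 1 hxβ))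
    · exact Submodule.smul_mem _ _ (pow_mem_powSpan (by norm_num))
    · exact powSpan_anti (by norm_num) (pow_mul_mem_powSpan 2 hz)
  refine ⟨loewyLength_eq (by rw [hjac, hIM1]) ?_, extDim_eq _ ![α, β, x] ?_ ?_ ?_⟩
  · rw [hjac, hIM, Ne, Ideal.span_singleton_eq_bot]
    exact hxM0
  · intro i
    rw [hjac]
    fin_cases i
    · exact hαI
    · exact hβI
    · exact hxI
  · intro y hy
    rw [hjac] at hy ⊢
    obtain ⟨s, t, u, w, z, hz, rfl⟩ := hdecomp y
    have hs : algebraMap k A s ∈ I := by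
      have h3 : algebraMap k A t * α + (algebraMap k A u * β + (algebraMap k A w * x + z)) ∈ I :=
        add_mem (Ideal.mul_mem_left _ _ hαI) (add_mem (Ideal.mul_mem_left _ _ hβI)
          (add_mem (Ideal.mul_mem_left _ _ hxI) (hx2I hz)))
      rw [add_assoc, add_assoc, add_assoc] at hy
      exact (Ideal.add_mem_iff_left I h3).mp hy
    have hs0 : algebraMap k A s = 0 := by
      by_contra h
      have hs1 : s ≠ 0 := fun h' => h (by rw [h', map_zero])
      have h3 := I.mul_mem_left (algebraMap k A s⁻¹) hs
      rw [← map_mul, inv_mul_cancel₀ hs1, map_one] at h3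
      rw [(Ideal.eq_top_iff_one I).mpr h3, Ideal.top_pow] at hIM1
      exact top_ne_bot hIM1
    refine ⟨![t, u, w], ?_⟩
    rw [hsq]
    convert powSpan_le_ideal hz using 1
    simp only [Fin.sum_univ_three, hs0, Matrix.cons_val]
    ring
  · intro c hc
    rw [hjac, hsq, Fin.sum_univ_three] at hc
    have h3 := hx2 _ hc
    simp only [Matrix.cons_val] at h3
    have h4 : algebraMap k A (c 0) * α + algebraMap k A (c 1) * β + algebraMap k A (c 2) * x =
        c 0 • B (Sum.inl 1) + c 1 • B (Sum.inl 2) + c 2 • B (Sum.inr ⟨0, by omega⟩) := by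
      simp [hB, v, Algebra.smul_def]
    rw [h4] at h3
    intro i
    fin_cases i
    · simpa [Finsupp.single_apply] using hcoord (Sum.inl 1) (by simp) _ h3
    · simpa [Finsupp.single_apply] using hcoord (Sum.inl 2) (by simp) _ h3
    · simpa [Finsupp.single_apply] using hcoord (Sum.inr ⟨0, by omega⟩) (by
        intro j hj h5
        simp only [Sum.inr.injEq] at h5
        rw [← h5] at hj
        simp at hj) _ h3

/-- The image of the maximal ideal `𝔭𝒪_𝔭` in the fraction field `K`. -/
def locIdealSet (𝒪 K : Type*) [CommRing 𝒪] [Field K] [Algebra 𝒪 K] (𝔭 : Ideal 𝒪) : Set K :=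
  {x | ∃ a b : 𝒪, a ∈ 𝔭 ∧ b ∉ 𝔭 ∧ x * algebraMap 𝒪 K b = algebraMap 𝒪 K a}

section locSet

variable {𝒪 K : Type*} [CommRing 𝒪] [Field K] [Algebra 𝒪 K] {𝔭 : Ideal 𝒪}

theorem algebraMap_mem_locSet [𝔭.IsPrime] (a : 𝒪) : algebraMap 𝒪 K a ∈ locSet 𝒪 K 𝔭 :=
  ⟨a, 1, fun h => Ideal.IsPrime.ne_top ‹_› ((Ideal.eq_top_iff_one 𝔭).mpr h), by simp⟩

theorem algebraMap_mem_locIdealSet [𝔭.IsPrime] {a : 𝒪} (ha : a ∈ 𝔭) :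
    algebraMap 𝒪 K a ∈ locIdealSet 𝒪 K 𝔭 :=
  ⟨a, 1, ha, fun h => Ideal.IsPrime.ne_top ‹_› ((Ideal.eq_top_iff_one 𝔭).mpr h), by simp⟩

theorem add_mem_locSet [𝔭.IsPrime] {x y : K} (hx : x ∈ locSet 𝒪 K 𝔭) (hy : y ∈ locSet 𝒪 K 𝔭) :
    x + y ∈ locSet 𝒪 K 𝔭 := by
  obtain ⟨a, b, hb, h⟩ := hx
  obtain ⟨c, d, hd, h'⟩ := hy
  refine ⟨a * d + c * b, b * d, fun hbd => (Ideal.IsPrime.mem_or_mem ‹_› hbd).elim hb hd, ?_⟩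
  simp only [map_mul, map_add]
  linear_combination algebraMap 𝒪 K d * h + algebraMap 𝒪 K b * h'

theorem mul_mem_locSet [𝔭.IsPrime] {x y : K} (hx : x ∈ locSet 𝒪 K 𝔭) (hy : y ∈ locSet 𝒪 K 𝔭) :
    x * y ∈ locSet 𝒪 K 𝔭 := by
  obtain ⟨a, b, hb, h⟩ := hx
  obtain ⟨c, d, hd, h'⟩ := hy
  refine ⟨a * c, b * d, fun hbd => (Ideal.IsPrime.mem_or_mem ‹_› hbd).elim hb hd, ?_⟩
  simp only [map_mul]
  rw [← h, ← h']
  ring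

theorem neg_mem_locSet {x : K} (hx : x ∈ locSet 𝒪 K 𝔭) : -x ∈ locSet 𝒪 K 𝔭 := by
  obtain ⟨a, b, hb, h⟩ := hx
  exact ⟨-a, b, hb, by rw [map_neg, neg_mul, h]⟩

theorem zero_mem_locSet [𝔭.IsPrime] : (0 : K) ∈ locSet 𝒪 K 𝔭 := by
  simpa using algebraMap_mem_locSet (K := K) (0 : 𝒪)

theorem one_mem_locSet [𝔭.IsPrime] : (1 : K) ∈ locSet 𝒪 K 𝔭 := by
  simpa using algebraMap_mem_locSet (K := K) (1 : 𝒪)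

theorem natCast_mem_locSet [𝔭.IsPrime] (n : ℕ) : (n : K) ∈ locSet 𝒪 K 𝔭 := by
  simpa using algebraMap_mem_locSet (K := K) (n : 𝒪)

theorem add_mem_locIdealSet [𝔭.IsPrime] {x y : K} (hx : x ∈ locIdealSet 𝒪 K 𝔭)
    (hy : y ∈ locIdealSet 𝒪 K 𝔭) : x + y ∈ locIdealSet 𝒪 K 𝔭 := by
  obtain ⟨a, b, ha, hb, h⟩ := hx
  obtain ⟨c, d, hc, hd, h'⟩ := hy
  refine ⟨a * d + c * b, b * d, add_mem (𝔭.mul_mem_right _ ha) (𝔭.mul_mem_right _ hc),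
    fun hbd => (Ideal.IsPrime.mem_or_mem ‹_› hbd).elim hb hd, ?_⟩
  simp only [map_mul, map_add]
  linear_combination algebraMap 𝒪 K d * h + algebraMap 𝒪 K b * h'

theorem neg_mem_locIdealSet {x : K} (hx : x ∈ locIdealSet 𝒪 K 𝔭) :
    -x ∈ locIdealSet 𝒪 K 𝔭 := by
  obtain ⟨a, b, ha, hb, h⟩ := hx
  exact ⟨-a, b, neg_mem ha, hb, by rw [map_neg, neg_mul, h]⟩

theorem zero_mem_locIdealSet [𝔭.IsPrime] : (0 : K) ∈ locIdealSet 𝒪 K 𝔭 := by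
  simpa using algebraMap_mem_locIdealSet (K := K) (zero_mem 𝔭)

theorem mul_mem_locIdealSet [𝔭.IsPrime] {x y : K} (hx : x ∈ locSet 𝒪 K 𝔭)
    (hy : y ∈ locIdealSet 𝒪 K 𝔭) : x * y ∈ locIdealSet 𝒪 K 𝔭 := by
  obtain ⟨a, b, hb, h⟩ := hx
  obtain ⟨c, d, hc, hd, h'⟩ := hy
  refine ⟨a * c, b * d, 𝔭.mul_mem_left _ hc,
    fun hbd => (Ideal.IsPrime.mem_or_mem ‹_› hbd).elim hb hd, ?_⟩
  simp only [map_mul]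
  rw [← h, ← h']
  ring

theorem mem_of_algebraMap_mem_locIdealSet [𝔭.IsPrime] [FaithfulSMul 𝒪 K] {a : 𝒪}
    (ha : algebraMap 𝒪 K a ∈ locIdealSet 𝒪 K 𝔭) : a ∈ 𝔭 := by
  obtain ⟨c, d, hc, hd, h⟩ := ha
  rw [← map_mul] at h
  have := FaithfulSMul.algebraMap_injective 𝒪 K h
  rw [← this] at hc
  exact (Ideal.IsPrime.mem_or_mem ‹_› hc).resolve_right hd

end locSet

section charSet

variable {K G P : Type} [Field K] [Group G] [Group P]

theorem trace_mem_charSet {n : Type} [Fintype n] [DecidableEq n] (ρ : G →* Matrix n n K) :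
    (fun g => (ρ g).trace) ∈ charSet K G := by
  refine ⟨FDRep.of (V := n → K)
    ((Matrix.toLinAlgEquiv' (R := K) (n := n)).toRingEquiv.toRingHom.toMonoidHom.comp ρ), ?_⟩
  funext g
  exact (Matrix.trace_toLin'_eq (ρ g)).symm

theorem one_mem_charSet : (1 : G → K) ∈ charSet K G := by
  convert trace_mem_charSet (1 : G →* Matrix (Fin 1) (Fin 1) K) using 1
  funext g
  simp

theorem mul_mem_charSet {f g : G → K} (hf : f ∈ charSet K G) (hg : g ∈ charSet K G) :
    f * g ∈ charSet K G := by
  obtain ⟨V, rfl⟩ := hf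
  obtain ⟨W, rfl⟩ := hg
  exact ⟨CategoryTheory.MonoidalCategoryStruct.tensorObj V W, (FDRep.char_tensor V W).symm⟩

theorem comp_mem_charSet {f : G → K} (hf : f ∈ charSet K G) (φ : P →* G) :
    f ∘ φ ∈ charSet K P := by
  obtain ⟨V, rfl⟩ := hf
  exact ⟨FDRep.of (V.ρ.comp φ), rfl⟩

theorem charSet_conj {f : G → K} (hf : f ∈ charSet K G) (x y : G) : f (y * x * y⁻¹) = f x := by
  obtain ⟨V, rfl⟩ := hf
  exact FDRep.char_conj V x y

/-- The average value of a function on a finite group. -/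
noncomputable def charAvg [Fintype G] : (G → K) →ₗ[K] K where
  toFun f := (Nat.card G : K)⁻¹ * ∑ g, f g
  map_add' f g := by simp [Finset.sum_add_distrib, mul_add]
  map_smul' c f := by simp [← Finset.mul_sum, mul_left_comm]

theorem exists_charAvg_eq_natCast [Fintype G] [CharZero K] {f : G → K} (hf : f ∈ charSet K G) :
    ∃ n : ℕ, charAvg f = n := by
  obtain ⟨V, rfl⟩ := hf
  have : (Nat.card G : K) ≠ 0 := Nat.cast_ne_zero.mpr Nat.card_pos.ne'
  let : Invertible (Nat.card G : K) := invertibleOfNonzero this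
  exact ⟨_, FDRep.average_char_eq_finrank_invariants V⟩

end charSet

theorem charAvg_const_mul {K P : Type} [Field K] [Fintype P] (x : K) (f : P → K) :
    charAvg (Function.const P x * f) = x * charAvg f :=
  charAvg.map_smul x f

section locCharRing

variable {𝒪 K G P : Type} [CommRing 𝒪] [Field K] [Algebra 𝒪 K] {𝔭 : Ideal 𝒪} [Group G] [Group P]

theorem const_mem_locCharRing {x : K} (hx : x ∈ locSet 𝒪 K 𝔭) :
    Function.const G x ∈ locCharRing 𝒪 K 𝔭 G :=
  Subring.subset_closure (Or.inl ⟨x, hx, rfl⟩)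

theorem charSet_subset_locCharRing : charSet K G ⊆ locCharRing 𝒪 K 𝔭 G :=
  fun _ hf => Subring.subset_closure (Or.inr hf)

theorem locCharRing_induction [𝔭.IsPrime] {p : (G → K) → Prop} (zero : p 0)
    (add : ∀ f g, p f → p g → p (f + g)) (neg : ∀ f, p f → p (-f))
    (smul : ∀ x ∈ locSet 𝒪 K 𝔭, ∀ f ∈ charSet K G, p (Function.const G x * f)) :
    ∀ f ∈ locCharRing 𝒪 K 𝔭 G, p f := by
  intro f hf
  have hmono : ∀ f ∈ Submonoid.closure
      ({f | ∃ x ∈ locSet 𝒪 K 𝔭, f = Function.const G x} ∪ charSet K G),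
      ∃ x ∈ locSet 𝒪 K 𝔭, ∃ χ ∈ charSet K G, f = Function.const G x * χ := by
    intro f hf
    induction hf using Submonoid.closure_induction with
    | mem f hf =>
      rcases hf with ⟨x, hx, rfl⟩ | hf
      · exact ⟨x, hx, 1, one_mem_charSet, (mul_one _).symm⟩
      · exact ⟨1, one_mem_locSet, f, hf, (one_mul f).symm⟩
    | one => exact ⟨1, one_mem_locSet, 1, one_mem_charSet, (one_mul 1).symm⟩
    | mul f g _ _ hf hg =>
      obtain ⟨x, hx, χ, hχ, rfl⟩ := hf
      obtain ⟨y, hy, θ, hθ, rfl⟩ := hg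
      exact ⟨x * y, mul_mem_locSet hx hy, χ * θ, mul_mem_charSet hχ hθ, by
        funext g
        simp only [Pi.mul_apply, Function.const_apply]
        ring⟩
  have hf' := Subring.mem_closure_iff.mp hf
  clear hf
  induction hf' using AddSubgroup.closure_induction with
  | mem f hf =>
    obtain ⟨x, hx, χ, hχ, rfl⟩ := hmono f hf
    exact smul x hx χ hχ
  | zero => exact zero
  | add f g _ _ hf hg => exact add f g hf hg
  | neg f _ hf => exact neg f hf

theorem locCharRing_conj [𝔭.IsPrime] {f : G → K} (hf : f ∈ locCharRing 𝒪 K 𝔭 G) (x y : G) :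
    f (y * x * y⁻¹) = f x := by
  refine locCharRing_induction (p := fun f => f (y * x * y⁻¹) = f x) rfl ?_ ?_ ?_ f hf
  · intro f g hf hg
    rw [Pi.add_apply, Pi.add_apply, hf, hg]
  · intro f hf
    rw [Pi.neg_apply, Pi.neg_apply, hf]
  · intro c _ f hf
    rw [Pi.mul_apply, Pi.mul_apply, charSet_conj hf]
    rfl

theorem charAvg_mem_locSet [𝔭.IsPrime] [CharZero K] [Fintype P] (φ : P →* G) {f : G → K}
    (hf : f ∈ locCharRing 𝒪 K 𝔭 G) {ψ : P → K} (hψ : ψ ∈ charSet K P) :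
    charAvg (f ∘ φ * ψ) ∈ locSet 𝒪 K 𝔭 := by
  refine locCharRing_induction (p := fun f => charAvg (f ∘ φ * ψ) ∈ locSet 𝒪 K 𝔭)
    ?_ ?_ ?_ ?_ f hf
  · convert zero_mem_locSet (𝔭 := 𝔭) using 1
    convert charAvg.map_zero using 2
    exact zero_mul ψ
  · intro f g hf hg
    convert add_mem_locSet hf hg using 1
    rw [← map_add, ← add_mul]
    rfl
  · intro f hf
    convert neg_mem_locSet hf using 1
    rw [← map_neg, ← neg_mul]
    rfl
  · intro x hx f hf
    obtain ⟨n, hn⟩ := exists_charAvg_eq_natCast (mul_mem_charSet (comp_mem_charSet hf φ) hψ)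
    have : charAvg ((Function.const G x * f) ∘ φ * ψ) = x * charAvg (f ∘ φ * ψ) := by
      rw [← charAvg_const_mul, ← mul_assoc]
      rfl
    rw [this, hn]
    exact mul_mem_locSet hx (natCast_mem_locSet n)

/-- The functions all of whose restricted averages against characters lie in `𝔭𝒪_𝔭`. -/
def avgIdeal (𝔭 : Ideal 𝒪) [𝔭.IsPrime] [Fintype P] (φ : P →* G) :
    Ideal (locCharRing 𝒪 K 𝔭 G) where
  carrier := {f | ∀ ψ ∈ charSet K P, charAvg (f.1 ∘ φ * ψ) ∈ locIdealSet 𝒪 K 𝔭}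
  zero_mem' := by
    intro ψ _
    convert zero_mem_locIdealSet (𝔭 := 𝔭) using 1
    convert charAvg.map_zero using 2
    exact zero_mul ψ
  add_mem' := by
    intro f g hf hg ψ hψ
    convert add_mem_locIdealSet (hf ψ hψ) (hg ψ hψ) using 1
    rw [← map_add, ← add_mul]
    rfl
  smul_mem' := by
    rintro ⟨c, hc⟩ ⟨f, _⟩ hf
    revert c
    intro c hc
    change ∀ ψ ∈ charSet K P, charAvg ((c * f) ∘ φ * ψ) ∈ locIdealSet 𝒪 K 𝔭
    revert c
    refine locCharRing_induction ?_ ?_ ?_ ?_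
    · intro ψ _
      convert zero_mem_locIdealSet (𝔭 := 𝔭) using 1
      convert charAvg.map_zero using 2
      rw [zero_mul]
      exact zero_mul ψ
    · intro c d hc hd ψ hψ
      convert add_mem_locIdealSet (hc ψ hψ) (hd ψ hψ) using 1
      rw [← map_add, ← add_mul, add_mul c]
      rfl
    · intro c hc ψ hψ
      convert neg_mem_locIdealSet (hc ψ hψ) using 1
      rw [← map_neg, ← neg_mul, neg_mul c]
      rfl
    · intro x hx θ hθ ψ hψ
      have := mul_mem_locIdealSet hx (hf _ (mul_mem_charSet (comp_mem_charSet hθ φ) hψ))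
      convert this using 1
      rw [← charAvg_const_mul]
      congr 1
      funext g
      simp only [Pi.mul_apply, Function.comp_apply, Function.const_apply]
      ring

theorem blockIdeal_le_avgIdeal [𝔭.IsPrime] [CharZero K] [Fintype P] (φ : P →* G)
    (e : locCharRing 𝒪 K 𝔭 G) (he : ∀ g, e.1 (φ g) = 1) :
    blockIdeal 𝒪 K 𝔭 G e ≤ avgIdeal 𝔭 φ := by
  refine sup_le (Ideal.span_le.mpr ?_) (Ideal.span_le.mpr ?_)
  · rintro f ⟨a, ha, hf⟩ ψ hψ
    obtain ⟨n, hn⟩ := exists_charAvg_eq_natCast hψ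
    have h := charAvg_const_mul (algebraMap 𝒪 K a) ψ
    rw [hf, show Function.const G (algebraMap 𝒪 K a) ∘ φ = Function.const P (algebraMap 𝒪 K a)
      from rfl, h, hn, mul_comm]
    exact mul_mem_locIdealSet (natCast_mem_locSet n) (algebraMap_mem_locIdealSet ha)
  · rintro f rfl ψ hψ
    convert zero_mem_locIdealSet (𝔭 := 𝔭) using 1
    convert charAvg.map_zero using 2
    funext g
    have : (1 - e).1 (φ g) = 1 - e.1 (φ g) := rfl
    rw [Pi.mul_apply, Function.comp_apply, this, he, sub_self, zero_mul]
    rfl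

/-- Inflation of virtual characters along `π : G → P`. -/
def charInfl (𝒪 : Type) [CommRing 𝒪] [Algebra 𝒪 K] (𝔭 : Ideal 𝒪) (π : G →* P) :
    charRing K P →+* locCharRing 𝒪 K 𝔭 G where
  toFun f := ⟨f.1 ∘ π, by
    have : charRing K P ≤ (locCharRing 𝒪 K 𝔭 G).comap
        (RingHom.pi fun x => Pi.evalRingHom (fun _ : P => K) (π x)) :=
      Subring.closure_le.mpr fun χ hχ => charSet_subset_locCharRing (comp_mem_charSet hχ π)
    exact this f.2⟩
  map_one' := rfl
  map_mul' _ _ := rfl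
  map_zero' := rfl
  map_add' _ _ := rfl

end locCharRing

theorem exists_const_sub_mem_pConstIdeal {𝒪 K G : Type} [CommRing 𝒪] [Field K] [Algebra 𝒪 K]
    {𝔭 : Ideal 𝒪} [𝔭.IsMaximal] [Group G] {x : K} (hx : x ∈ locSet 𝒪 K 𝔭) :
    ∃ a : 𝒪, (⟨Function.const G x, const_mem_locCharRing hx⟩ : locCharRing 𝒪 K 𝔭 G) -
      constRingHom 𝒪 K 𝔭 G a ∈ pConstIdeal 𝒪 K 𝔭 G := by
  have hx' := hx
  obtain ⟨a, b, hb, h⟩ := hx'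
  obtain ⟨b', i, hi, hb'⟩ := Ideal.IsMaximal.exists_inv ‹𝔭.IsMaximal› hb
  refine ⟨a * b', ?_⟩
  have : (⟨Function.const G x, const_mem_locCharRing hx⟩ : locCharRing 𝒪 K 𝔭 G) -
      constRingHom 𝒪 K 𝔭 G (a * b') =
      ⟨Function.const G x, const_mem_locCharRing hx⟩ * constRingHom 𝒪 K 𝔭 G i := by
    refine Subtype.ext (funext fun g => ?_)
    change x - algebraMap 𝒪 K (a * b') = x * algebraMap 𝒪 K i
    have h1 := congrArg (algebraMap 𝒪 K) hb'
    simp only [map_mul, map_add, map_one] at h1 ⊢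
    linear_combination -x * h1 + algebraMap 𝒪 K b' * h
  rw [this]
  exact Ideal.mul_mem_left _ _ (Ideal.subset_span ⟨i, hi, rfl⟩)

section block

variable {𝒪 K G P : Type} [CommRing 𝒪] [Field K] [Algebra 𝒪 K] {𝔭 : Ideal 𝒪} [𝔭.IsMaximal]
  [Group G] [Group P] [Fintype P] [CharZero K] {φ : P →* G} {π : G →* P}
  {e : locCharRing 𝒪 K 𝔭 G} {ι : Type*} [Fintype ι] {ψ : ι → charRing K P}

theorem block_spanned (hπφ : ∀ g, π (φ g) = g)
    (hvan : ∀ f : G → K, (∀ x y, f (y * x * y⁻¹) = f x) → (∀ g, f (φ g) = 0) →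
      ∀ x, e.1 x * f x = 0)
    (hψ : ∀ i, (ψ i).1 ∈ charSet K P)
    (hcompl : ∀ f : P → K, (∀ x y, f (y * x * y⁻¹) = f x) →
      f = ∑ i, charAvg (f * (ψ i).1) • (ψ i).1) (y : blockAlg 𝒪 K 𝔭 G e) :
    ∃ c : ι → 𝒪 ⧸ 𝔭, y = ∑ i, blockScalars 𝒪 K 𝔭 G e (c i) *
      Ideal.Quotient.mk (blockIdeal 𝒪 K 𝔭 G e) (charInfl 𝒪 𝔭 π (ψ i)) := by
  obtain ⟨f, rfl⟩ := Ideal.Quotient.mk_surjective y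
  have hmem : ∀ i, charAvg (f.1 ∘ φ * (ψ i).1) ∈ locSet 𝒪 K 𝔭 :=
    fun i => charAvg_mem_locSet φ f.2 (hψ i)
  choose c hc using fun i => exists_const_sub_mem_pConstIdeal (G := G) (hmem i)
  refine ⟨fun i => Ideal.Quotient.mk 𝔭 (c i), ?_⟩
  set C : ι → locCharRing 𝒪 K 𝔭 G := fun i => ⟨_, const_mem_locCharRing (hmem i)⟩ with hC
  have h1 : ∀ i, blockScalars 𝒪 K 𝔭 G e (Ideal.Quotient.mk 𝔭 (c i)) =
      Ideal.Quotient.mk (blockIdeal 𝒪 K 𝔭 G e) (C i) := fun i =>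
    ((Ideal.Quotient.eq).mpr ((le_sup_left : _ ≤ blockIdeal 𝒪 K 𝔭 G e) (hc i))).symm
  simp only [h1]
  simp only [← map_mul]
  rw [← map_sum, Ideal.Quotient.eq]
  set s := f - ∑ i, C i * charInfl 𝒪 𝔭 π (ψ i) with hs
  have hs0 : ∀ g, s.1 (φ g) = 0 := by
    intro g
    have h2 := congrFun (hcompl (f.1 ∘ φ) fun x y => by
      simp only [Function.comp_apply, map_mul, map_inv]
      exact locCharRing_conj f.2 _ _) g
    have h3 : s.1 (φ g) = f.1 (φ g) -
        (∑ i, (C i).1 * (charInfl 𝒪 𝔭 π (ψ i)).1) (φ g) := by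
      rw [hs, AddSubgroupClass.coe_sub, AddSubmonoidClass.coe_finsetSum]
      rfl
    rw [h3, sub_eq_zero]
    refine h2.trans ?_
    simp only [Finset.sum_apply]
    refine Finset.sum_congr rfl fun i _ => ?_
    change _ = charAvg (f.1 ∘ φ * (ψ i).1) * (ψ i).1 (π (φ g))
    rw [hπφ]
    rfl
  have h4 : s = s * (1 - e) := by
    refine Subtype.ext (funext fun x => ?_)
    have := hvan s.1 (fun x y => locCharRing_conj s.2 x y) hs0 x
    change s.1 x = s.1 x * (1 - e.1 x)
    linear_combination this
  rw [h4]
  exact (le_sup_right : _ ≤ blockIdeal 𝒪 K 𝔭 G e)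
    (Ideal.mul_mem_left _ _ (Ideal.mem_span_singleton_self _))

theorem block_independent [FaithfulSMul 𝒪 K] (hπφ : ∀ g, π (φ g) = g) (he : ∀ g, e.1 (φ g) = 1)
    (hψ : ∀ i, (ψ i).1 ∈ charSet K P)
    (horth : ∀ i j, charAvg ((ψ i).1 * (ψ j).1) = if i = j then (1 : K) else 0)
    (c : ι → 𝒪 ⧸ 𝔭) (hc : ∑ i, blockScalars 𝒪 K 𝔭 G e (c i) *
      Ideal.Quotient.mk (blockIdeal 𝒪 K 𝔭 G e) (charInfl 𝒪 𝔭 π (ψ i)) = 0) (j : ι) :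
    c j = 0 := by
  choose d hd using fun i => Ideal.Quotient.mk_surjective (c i)
  have h1 : ∀ i, blockScalars 𝒪 K 𝔭 G e (c i) =
      Ideal.Quotient.mk (blockIdeal 𝒪 K 𝔭 G e) (constRingHom 𝒪 K 𝔭 G (d i)) := fun i => by
    rw [← hd]; rfl
  simp only [h1] at hc
  simp only [← map_mul] at hc
  rw [← map_sum, Ideal.Quotient.eq_zero_iff_mem] at hc
  have h2 := blockIdeal_le_avgIdeal φ e he hc _ (hψ j)
  have h3 : (∑ i, constRingHom 𝒪 K 𝔭 G (d i) * charInfl 𝒪 𝔭 π (ψ i)).1 ∘ φ * (ψ j).1 =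
      ∑ i, algebraMap 𝒪 K (d i) • ((ψ i).1 * (ψ j).1) := by
    funext g
    rw [AddSubmonoidClass.coe_finsetSum]
    simp only [Pi.mul_apply, Function.comp_apply, Finset.sum_apply, Finset.sum_mul]
    refine Finset.sum_congr rfl fun i _ => ?_
    change algebraMap 𝒪 K (d i) * (ψ i).1 (π (φ g)) * (ψ j).1 g =
      algebraMap 𝒪 K (d i) * ((ψ i).1 g * (ψ j).1 g)
    rw [hπφ, mul_assoc]
  rw [h3, map_sum] at h2
  simp only [map_smul, horth, smul_eq_mul, mul_ite, mul_one, mul_zero, Finset.sum_ite_eq',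
    Finset.mem_univ, if_true] at h2
  rw [← hd, Ideal.Quotient.eq_zero_iff_mem]
  exact mem_of_algebraMap_mem_locIdealSet h2

end block

theorem ZMod.sum_eq_sum_range {R : Type*} [AddCommMonoid R] (n : ℕ) [NeZero n] (g : ZMod n → R) :
    ∑ t, g t = ∑ i ∈ Finset.range n, g i :=
  Finset.sum_nbij' ZMod.val (fun i => (i : ZMod n)) (fun t _ => Finset.mem_range.mpr t.val_lt)
    (fun _ _ => Finset.mem_univ _) (fun t _ => ZMod.natCast_zmod_val t)
    (fun i hi => ZMod.val_cast_of_lt (Finset.mem_range.mp hi))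
    (fun t _ => by rw [ZMod.natCast_zmod_val])

/-- Sums over `ℤ/2M` of even functions, grouping `t` and `-t`. -/
theorem ZMod.sum_eq_add_sum_add_neg {R : Type*} [AddCommMonoid R] {q M : ℕ} [NeZero q]
    (hM : 0 < M) (hq : q = 2 * M) (g : ZMod q → R) :
    ∑ t, g t = g 0 + g M + ∑ i : Fin (M - 1), (g (((i : ℕ) : ℤ) + 1 : ℤ) +
      g (-((((i : ℕ) : ℤ) + 1 : ℤ) : ZMod q))) := by
  obtain ⟨N, rfl⟩ : ∃ N, M = N + 1 := ⟨M - 1, by omega⟩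
  have h1 := Finset.sum_range_reflect (fun i => g ((N + 1 + (i + 1) : ℕ) : ZMod q)) N
  rw [ZMod.sum_eq_sum_range, show Finset.range q = Finset.range ((N + 1) + (N + 1)) by
    rw [hq, two_mul], Finset.sum_range_add, Finset.sum_range_succ', Finset.sum_range_succ', ← h1,
    Nat.add_sub_cancel, Fin.sum_univ_eq_sum_range
      (fun i => g ((i : ℤ) + 1 : ℤ) + g (-(((i : ℤ) + 1 : ℤ) : ZMod q))), Finset.sum_add_distrib]
  have h2 : ∀ i ∈ Finset.range N, g ((N + 1 + (N - 1 - i + 1) : ℕ) : ZMod q) =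
      g (-(((i : ℤ) + 1 : ℤ) : ZMod q)) := by
    intro i hi
    congr 1
    rw [eq_neg_iff_add_eq_zero]
    have : N + 1 + (N - 1 - i + 1) + (i + 1) = q := by
      have := Finset.mem_range.mp hi
      omega
    have h3 := congrArg (Nat.cast (R := ZMod q)) this
    rw [ZMod.natCast_self, Nat.cast_add] at h3
    rw [← h3]
    push_cast
    rfl
  rw [Finset.sum_congr rfl h2]
  push_cast
  rw [add_zero]
  abel

theorem monoidHom_mem_charSet {K G : Type} [Field K] [Group G] (ρ : G →* K) :
    (ρ : G → K) ∈ charSet K G := by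
  convert trace_mem_charSet
    ((Matrix.scalar (Fin 1) : K →+* Matrix (Fin 1) (Fin 1) K).toMonoidHom.comp ρ) using 1
  funext g
  simp

namespace DihedralGroup

variable {K : Type} [Field K] {q : ℕ}

/-- The linear character of a dihedral group which is trivial exactly on the rotations. -/
def signChar (K : Type) [Field K] (q : ℕ) : DihedralGroup q →* K where
  toFun
    | r _ => 1
    | sr _ => -1
  map_one' := rfl
  map_mul' := by rintro (i | i) (j | j) <;> simp

@[simp]
theorem signChar_r (j : ZMod q) : signChar K q (r j) = 1 := rfl

@[simp]
theorem signChar_sr (j : ZMod q) : signChar K q (sr j) = -1 := rfl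

/-- The linear character sending `r j` and `sr j` to `ψ (c * j)`, for `c` of order at most `2`. -/
def twistChar (ψ : AddChar (ZMod q) K) (c : ZMod q) (hc : c + c = 0) : DihedralGroup q →* K where
  toFun
    | r j => ψ (c * j)
    | sr j => ψ (c * j)
  map_one' := by
    change ψ (c * 0) = 1
    simp
  map_mul' := by
    have h : ∀ i j, c * (j - i) = c * i + c * j := fun i j => by
      linear_combination -i * hc
    rintro (i | i) (j | j) <;> simp [h, mul_add, AddChar.map_add_eq_mul]

@[simp]
theorem twistChar_r (ψ : AddChar (ZMod q) K) (c : ZMod q) (hc : c + c = 0) (j : ZMod q) :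
    twistChar ψ c hc (r j) = ψ (c * j) := rfl

@[simp]
theorem twistChar_sr (ψ : AddChar (ZMod q) K) (c : ZMod q) (hc : c + c = 0) (j : ZMod q) :
    twistChar ψ c hc (sr j) = ψ (c * j) := rfl

/-- The character of a dihedral group induced from the character `r j ↦ ψ (t * j)` of the
subgroup of rotations. -/
def rotChar (ψ : AddChar (ZMod q) K) (t : ZMod q) : DihedralGroup q → K
  | r j => ψ (t * j) + ψ (-(t * j))
  | sr _ => 0

@[simp]
theorem rotChar_r (ψ : AddChar (ZMod q) K) (t j : ZMod q) :
    rotChar ψ t (r j) = ψ (t * j) + ψ (-(t * j)) := rfl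

@[simp]
theorem rotChar_sr (ψ : AddChar (ZMod q) K) (t j : ZMod q) : rotChar ψ t (sr j) = 0 := rfl

theorem rotChar_mem_charSet (ψ : AddChar (ZMod q) K) (t : ZMod q) :
    rotChar ψ t ∈ charSet K (DihedralGroup q) := by
  convert trace_mem_charSet (n := Fin 2) (G := DihedralGroup q) (K := K)
    { toFun := fun
        | r j => !![ψ (t * j), 0; 0, ψ (-(t * j))]
        | sr j => !![0, ψ (-(t * j)); ψ (t * j), 0]
      map_one' := by
        change !![ψ (t * 0), 0; 0, ψ (-(t * 0))] = 1
        simp [Matrix.one_fin_two]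
      map_mul' := by
        rintro (i | i) (j | j) <;>
        simp [← AddChar.map_add_eq_mul] <;> constructor <;> congr 1 <;> ring }
    using 1
  funext g
  rcases g with j | j <;> simp [Matrix.trace_fin_two]

theorem signChar_mul_self : (signChar K q : DihedralGroup q → K) * signChar K q = 1 := by
  funext g
  rcases g with j | j <;> simp

theorem twistChar_mul_self (ψ : AddChar (ZMod q) K) (c : ZMod q) (hc : c + c = 0) :
    (twistChar ψ c hc : DihedralGroup q → K) * twistChar ψ c hc = 1 := by
  funext g
  rcases g with j | j <;> simp [← AddChar.map_add_eq_mul, ← add_mul, hc]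

theorem rotChar_mul (ψ : AddChar (ZMod q) K) (s t : ZMod q) :
    rotChar ψ s * rotChar ψ t = rotChar ψ (s + t) + rotChar ψ (s - t) := by
  funext g
  rcases g with j | j
  · simp only [rotChar_r, Pi.mul_apply, Pi.add_apply, mul_add, add_mul, neg_add, neg_mul,
      sub_eq_add_neg, neg_neg, AddChar.map_add_eq_mul]
    ring
  · simp

theorem rotChar_neg (ψ : AddChar (ZMod q) K) (t : ZMod q) : rotChar ψ (-t) = rotChar ψ t := by
  funext g
  rcases g with j | j <;> simp [add_comm]

theorem rotChar_zero (ψ : AddChar (ZMod q) K) : rotChar ψ 0 = 1 + signChar K q := by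
  funext g
  rcases g with j | j <;> simp

theorem signChar_mul_rotChar (ψ : AddChar (ZMod q) K) (t : ZMod q) :
    (signChar K q : DihedralGroup q → K) * rotChar ψ t = rotChar ψ t := by
  funext g
  rcases g with j | j <;> simp

theorem twistChar_mul_rotChar (ψ : AddChar (ZMod q) K) (c : ZMod q) (hc : c + c = 0) (t : ZMod q) :
    (twistChar ψ c hc : DihedralGroup q → K) * rotChar ψ t = rotChar ψ (t + c) := by
  funext g
  rcases g with j | j
  · have h : -((t + c) * j) = c * j + -(t * j) := by linear_combination -j * hc
    have h' : (t + c) * j = c * j + t * j := by ring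
    rw [Pi.mul_apply, twistChar_r, rotChar_r, rotChar_r, h, h', AddChar.map_add_eq_mul,
      AddChar.map_add_eq_mul]
    ring
  · simp

theorem rotChar_eq (ψ : AddChar (ZMod q) K) (c : ZMod q) (hc : c + c = 0) :
    rotChar ψ c = twistChar ψ c hc + signChar K q * twistChar ψ c hc := by
  have h := twistChar_mul_rotChar ψ c hc 0
  rw [rotChar_zero, zero_add] at h
  rw [← h]
  ring

variable [NeZero q]

theorem sum_eq {R : Type*} [AddCommMonoid R] (f : DihedralGroup q → R) :
    ∑ g, f g = ∑ j, f (r j) + ∑ j, f (sr j) := by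
  rw [← equivSum.symm.sum_comp, Fintype.sum_sum_type]
  rfl

theorem charAvg_eq (f : DihedralGroup q → K) :
    charAvg f = (2 * q : K)⁻¹ * (∑ j, f (r j) + ∑ j, f (sr j)) := by
  rw [← sum_eq]
  change (Nat.card (DihedralGroup q) : K)⁻¹ * _ = _
  rw [nat_card]
  push_cast
  rfl

theorem charAvg_signChar : charAvg (signChar K q : DihedralGroup q → K) = 0 := by
  rw [charAvg_eq]
  simp

theorem charAvg_twistChar {ψ : AddChar (ZMod q) K} (hψ : ψ.IsPrimitive) (c : ZMod q)
    (hc : c + c = 0) (hc0 : c ≠ 0) :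
    charAvg (twistChar ψ c hc : DihedralGroup q → K) = 0 := by
  have h := AddChar.sum_mulShift c hψ
  simp only [mul_comm _ c, if_neg hc0, Nat.cast_zero] at h
  rw [charAvg_eq]
  simp [h]

variable [CharZero K]

theorem charAvg_one : charAvg (1 : DihedralGroup q → K) = 1 := by
  have : (q : K) ≠ 0 := NeZero.ne _
  rw [charAvg_eq]
  simp
  field_simp
  norm_num

theorem charAvg_rotChar {ψ : AddChar (ZMod q) K} (hψ : ψ.IsPrimitive) (t : ZMod q) :
    charAvg (rotChar ψ t) = if t = 0 then 1 else 0 := by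
  have : (q : K) ≠ 0 := NeZero.ne _
  have h1 := AddChar.sum_mulShift t hψ
  have h2 := AddChar.sum_mulShift (-t) hψ
  simp only [mul_neg, mul_comm _ t, neg_eq_zero, ZMod.card] at h1 h2
  rw [charAvg_eq]
  simp only [rotChar_r, rotChar_sr, Finset.sum_add_distrib, h1, h2]
  split_ifs
  · simp
    field_simp
    norm_num
  · simp

/-- The irreducible characters of the dihedral group of order `2q`, where `q = 2M`. -/
noncomputable def irrChar (ψ : AddChar (ZMod q) K) (M : ℕ) (hM : (M + M : ZMod q) = 0) :
    Fin 4 ⊕ Fin (M - 1) → DihedralGroup q → K :=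
  Sum.elim ![1, signChar K q, twistChar ψ M hM, signChar K q * twistChar ψ M hM]
    fun i => rotChar ψ (((i : ℕ) + 1 : ℤ) : ZMod q)

theorem charAvg_irrChar_mul {ψ : AddChar (ZMod q) K} (hψ : ψ.IsPrimitive) {M : ℕ} (h0 : 0 < M)
    (hq : q = 2 * M) (hM : (M + M : ZMod q) = 0) (i j : Fin 4 ⊕ Fin (M - 1)) :
    charAvg (irrChar ψ M hM i * irrChar ψ M hM j) = if i = j then (1 : K) else 0 := by
  have hz : ∀ a : ℤ, ((a : ℤ) : ZMod q) = 0 ↔ (2 * M : ℤ) ∣ a := fun a => by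
    rw [ZMod.intCast_zmod_eq_zero_iff_dvd, hq]
    push_cast
    rfl
  have hM0 : (M : ZMod q) ≠ 0 := by
    have := (hz M).not.mpr (fun h => by have := Int.le_of_dvd (by omega) h; omega)
    simpa using this
  have ht := charAvg_twistChar hψ M hM hM0
  have hst : charAvg (⇑(signChar K q) * ⇑(twistChar ψ M hM)) = 0 := by
    have h := charAvg_rotChar hψ (M : ZMod q)
    rw [rotChar_eq ψ M hM, map_add, ht, zero_add, if_neg hM0] at h
    exact h
  have hs : charAvg ⇑(signChar K q) = 0 := charAvg_signChar
  set a : DihedralGroup q → K := ⇑(signChar K q) with ha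
  set b : DihedralGroup q → K := ⇑(twistChar ψ (M : ZMod q) hM) with hb
  have haa : a * a = 1 := signChar_mul_self
  have hbb : b * b = 1 := twistChar_mul_self ψ M hM
  have hlin : ∀ i j : Fin 4, charAvg ((![1, a, b, a * b] : Fin 4 → DihedralGroup q → K) i *
      (![1, a, b, a * b] : Fin 4 → DihedralGroup q → K) j) = if i = j then (1 : K) else 0 := by
    have e1 : a * (a * b) = b := by rw [← mul_assoc, haa, one_mul]
    have e2 : b * (a * b) = a := by rw [mul_left_comm, hbb, mul_one]
    have e3 : a * b * a = b := by rw [mul_comm, e1]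
    have e4 : a * b * b = a := by rw [mul_assoc, hbb, mul_one]
    have e5 : a * b * (a * b) = 1 := by rw [mul_mul_mul_comm, haa, hbb, one_mul]
    intro i j
    fin_cases i <;> fin_cases j <;>
      simp [haa, hbb, e1, e2, e3, e4, e5, charAvg_one, hs, ht, hst, mul_comm b a]
  have hrot : ∀ t : ZMod q, t ≠ 0 → charAvg (rotChar ψ t) = 0 := fun t h => by
    rw [charAvg_rotChar hψ, if_neg h]
  have hmix : ∀ (i : Fin 4) (j : Fin (M - 1)),
      charAvg ((![1, a, b, a * b] : Fin 4 → DihedralGroup q → K) i *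
        rotChar ψ (((j : ℕ) + 1 : ℤ) : ZMod q)) = 0 := by
    intro i j
    have hj := j.2
    have z1 : charAvg (rotChar ψ (((j : ℕ) + 1 : ℤ) : ZMod q)) = 0 :=
      hrot _ ((hz _).not.mpr fun h => by have := Int.le_of_dvd (by omega) h; omega)
    have z2 : charAvg (rotChar ψ ((((j : ℕ) + 1 : ℤ) : ZMod q) + M)) = 0 := by
      refine hrot _ ?_
      have := (hz (((j : ℕ) + 1 : ℤ) + M)).not.mpr
        fun h => by have := Int.le_of_dvd (by omega) h; omega
      simpa using this
    have e1 := signChar_mul_rotChar ψ (((j : ℕ) + 1 : ℤ) : ZMod q)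
    have e2 := twistChar_mul_rotChar ψ M hM (((j : ℕ) + 1 : ℤ) : ZMod q)
    rw [← ha] at e1
    rw [← hb] at e2
    have e3 : a * b * rotChar ψ (((j : ℕ) + 1 : ℤ) : ZMod q) =
        rotChar ψ ((((j : ℕ) + 1 : ℤ) : ZMod q) + M) := by
      rw [mul_assoc, e2, signChar_mul_rotChar]
    fin_cases i
    · exact (congrArg charAvg (one_mul _)).trans z1
    · exact (congrArg charAvg e1).trans z1
    · exact (congrArg charAvg e2).trans z2
    · exact (congrArg charAvg e3).trans z2
  rcases i with i | i <;> rcases j with j | j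
  · simpa [irrChar] using hlin i j
  · simpa [irrChar] using hmix i j
  · rw [mul_comm]
    simpa [irrChar] using hmix j i
  · simp only [irrChar, Sum.elim_inr, rotChar_mul, map_add, Sum.inr.injEq]
    rw [← Int.cast_add, ← Int.cast_sub, charAvg_rotChar hψ, charAvg_rotChar hψ]
    simp only [hz]
    rw [if_neg, zero_add]
    · have : (2 * M : ℤ) ∣ (i : ℕ) + 1 - ((j : ℕ) + 1 : ℤ) ↔ i = j := by
        constructor
        · intro h
          have := Int.eq_zero_of_abs_lt_dvd h (by rw [abs_lt]; constructor <;> omega)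
          exact Fin.ext (by omega)
        · rintro rfl
          simp
      simp only [this]
    · intro h
      have := Int.le_of_dvd (by omega) h
      omega

theorem sum_charAvg_mul_rotChar {ψ : AddChar (ZMod q) K} (hψ : ψ.IsPrimitive)
    {f : DihedralGroup q → K} (hf : ∀ j, f (r (-j)) = f (r j)) (j : ZMod q) :
    ∑ t, charAvg (f * rotChar ψ t) * ψ (t * j) = f (r j) := by
  have hq : (q : K) ≠ 0 := NeZero.ne _
  have hF : ∀ t, charAvg (f * rotChar ψ t) = (q : K)⁻¹ * ∑ i, f (r i) * ψ (t * i) := by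
    intro t
    have h : ∑ i, f (r i) * ψ (-(t * i)) = ∑ i, f (r i) * ψ (t * i) := by
      rw [← Equiv.sum_comp (Equiv.neg (ZMod q))]
      simp [hf]
    rw [charAvg_eq]
    simp only [Pi.mul_apply, rotChar_r, rotChar_sr, mul_add, Finset.sum_add_distrib, h, mul_zero,
      Finset.sum_const_zero, add_zero]
    field_simp
    ring
  have h1 : ∀ t, charAvg (f * rotChar ψ t) * ψ (t * j) =
      (q : K)⁻¹ * ∑ i, f (r i) * ψ (t * (i + j)) := fun t => by
    simp only [hF, mul_assoc, Finset.sum_mul, mul_add t, AddChar.map_add_eq_mul]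
  simp only [h1]
  rw [← Finset.mul_sum, Finset.sum_comm]
  simp only [← Finset.mul_sum, AddChar.sum_mulShift _ hψ, ZMod.card, add_eq_zero_iff_eq_neg]
  simp [hf]
  field_simp

theorem sum_mul_one_add {ψ : AddChar (ZMod q) K} (hψ : ψ.IsPrimitive) {c : ZMod q}
    (hc : c + c = 0) (hc0 : c ≠ 0) {h : ZMod q → K} (hh : ∀ j k, h (j + (k + k)) = h j)
    (j : ZMod q) : ∑ i, h i * (1 + ψ (c * i) * ψ (c * j)) = q * h j := by
  have hodd : ψ c = -1 := by
    have h1 : ψ c * ψ c = 1 := by rw [← AddChar.map_add_eq_mul, hc, AddChar.map_zero_eq_one]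
    refine (mul_self_eq_one_iff.mp h1).resolve_left fun h2 => hc0 ?_
    exact (hψ.zmod_char_eq_one_iff q c).mp h2
  have h1 : ∀ d, h (j + d) * (1 + ψ (c * d)) = h j * (1 + ψ (d * c)) := by
    intro d
    rw [mul_comm d c]
    rcases Nat.even_or_odd' d.val with ⟨k, hk | hk⟩
    · have : d = k + k := by
        rw [← ZMod.natCast_zmod_val d, hk]
        push_cast
        ring
      rw [this, hh]
    · have : c * d = c := by
        rw [← ZMod.natCast_zmod_val d, hk]
        push_cast
        linear_combination k * hc
      rw [this, hodd]
      ring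
  rw [← Equiv.sum_comp (Equiv.addLeft j)]
  have h2 : ∀ d, ψ (c * (j + d)) * ψ (c * j) = ψ (c * d) := fun d => by
    rw [← AddChar.map_add_eq_mul]
    congr 1
    linear_combination j * hc
  simp only [Equiv.coe_addLeft, h2, h1]
  rw [← Finset.mul_sum, Finset.sum_add_distrib, AddChar.sum_mulShift c hψ, if_neg hc0]
  simp [mul_comm]

theorem eq_sum_irrChar {ψ : AddChar (ZMod q) K} (hψ : ψ.IsPrimitive) {M : ℕ} (h0 : 0 < M)
    (hq : q = 2 * M) (hM : (M + M : ZMod q) = 0) {f : DihedralGroup q → K}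
    (hf : ∀ x y, f (y * x * y⁻¹) = f x) :
    f = ∑ i, charAvg (f * irrChar ψ M hM i) • irrChar ψ M hM i := by
  have hM0 : (M : ZMod q) ≠ 0 := by
    rw [Ne, ZMod.natCast_eq_zero_iff]
    exact fun h => by have := Nat.le_of_dvd h0 h; omega
  have hq0 : (q : K) ≠ 0 := NeZero.ne _
  have hfr : ∀ j, f (r (-j)) = f (r j) := fun j => by
    have := hf (r j) (sr 0)
    simpa using this
  have hfs : ∀ j k, f (sr (j + (k + k))) = f (sr j) := fun j k => by
    have := hf (sr j) (r (-k))
    rw [← this]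
    simp [add_assoc]
  have hl : ∀ g, ∑ i, charAvg (f * irrChar ψ M hM i) * irrChar ψ M hM i g =
      charAvg f + charAvg (f * ⇑(signChar K q)) * signChar K q g +
      charAvg (f * ⇑(twistChar ψ M hM)) * twistChar ψ M hM g +
      charAvg (f * (⇑(signChar K q) * ⇑(twistChar ψ M hM))) *
        (signChar K q g * twistChar ψ M hM g) +
      ∑ i : Fin (M - 1), charAvg (f * rotChar ψ (((i : ℕ) + 1 : ℤ) : ZMod q)) *
        rotChar ψ (((i : ℕ) + 1 : ℤ) : ZMod q) g := by
    intro g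
    rw [Fintype.sum_sum_type, Fin.sum_univ_four]
    simp [irrChar]
  funext g
  simp only [Finset.sum_apply, Pi.smul_apply, smul_eq_mul]
  rw [hl]
  rcases g with j | j
  · have e0 : charAvg (f * rotChar ψ 0) = charAvg f + charAvg (f * ⇑(signChar K q)) := by
      rw [rotChar_zero, mul_add, map_add, mul_one]
    have e1 : charAvg (f * rotChar ψ M) = charAvg (f * ⇑(twistChar ψ M hM)) +
        charAvg (f * (⇑(signChar K q) * ⇑(twistChar ψ M hM))) := by
      rw [rotChar_eq ψ M hM, mul_add, map_add]
    rw [← sum_charAvg_mul_rotChar hψ hfr j, ZMod.sum_eq_add_sum_add_neg h0 hq, e0, e1]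
    simp only [rotChar_neg, rotChar_r, signChar_r, twistChar_r, neg_mul, zero_mul, mul_add,
      AddChar.map_zero_eq_one]
    ring
  · have e0 : charAvg f - charAvg (f * ⇑(signChar K q)) = (q : K)⁻¹ * ∑ i, f (sr i) := by
      rw [charAvg_eq, charAvg_eq]
      simp
      field_simp
      ring
    have e1 : charAvg (f * ⇑(twistChar ψ M hM)) -
        charAvg (f * (⇑(signChar K q) * ⇑(twistChar ψ M hM))) =
        (q : K)⁻¹ * ∑ i, f (sr i) * ψ (M * i) := by
      rw [charAvg_eq, charAvg_eq]
      simp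
      field_simp
      ring
    have h := sum_mul_one_add hψ hM hM0 (h := fun j => f (sr j)) hfs j
    simp only [mul_add, mul_one, Finset.sum_add_distrib, ← mul_assoc, ← Finset.sum_mul] at h
    simp only [rotChar_sr, signChar_sr, twistChar_sr, mul_zero, Finset.sum_const_zero]
    have h' : f (sr j) = (q : K)⁻¹ * ∑ i, f (sr i) +
        (q : K)⁻¹ * (∑ i, f (sr i) * ψ (M * i)) * ψ (M * j) := by
      field_simp
      rw [mul_comm, ← h]
    rw [h', ← e0, ← e1]
    ring

end DihedralGroup

theorem pPrimePart_eq_one_iff {G : Type*} [Group G] [Finite G] {p : ℕ} (hp : p.Prime) (g : G) :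
    pPrimePart p g = 1 ↔ IsPElement p g := by
  have ho : orderOf g ≠ 0 := (orderOf_pos g).ne'
  have hmul := Nat.ordProj_mul_ordCompl_eq_self (orderOf g) p
  have hcop := Nat.coprime_ordCompl hp ho
  unfold pPrimePart
  set s := (orderOf g).factorization p
  set o := orderOf g / p ^ s with hod
  have hs : 0 < p ^ s := pow_pos hp.pos s
  have ho0 : o ≠ 0 := fun h => ho (by rw [← hmul, h, mul_zero])
  have : NeZero o := ⟨ho0⟩
  rw [← orderOf_dvd_iff_pow_eq_one]
  constructor
  · intro h
    rw [← hmul] at h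
    have h1 := Nat.eq_zero_of_dvd_of_lt (Nat.dvd_of_mul_dvd_mul_left hs h) (ZMod.val_lt _)
    have h2 := (ZMod.val_eq_zero _).mp h1
    have h3 := ZMod.coe_mul_inv_eq_one (p ^ s) (hcop.pow_left s)
    rw [Nat.cast_pow, h2, mul_zero] at h3
    have h4 : ((1 : ℕ) : ZMod o) = 0 := by rw [Nat.cast_one, h3]
    have h5 := Nat.dvd_one.mp ((ZMod.natCast_eq_zero_iff _ _).mp h4)
    exact ⟨s, by rw [← hmul, h5, mul_one]⟩
  · rintro ⟨a, ha⟩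
    have h1 : o ∣ p ^ a := ⟨p ^ s, by rw [← ha, ← hmul, mul_comm]⟩
    have h2 : o = 1 := (hcop.pow_left a).symm.eq_one_of_dvd h1
    have h3 := ZMod.val_lt (((p : ZMod o) ^ s)⁻¹)
    rw [show ZMod.val (((p : ZMod o) ^ s)⁻¹) = 0 by omega, mul_zero]
    exact dvd_zero _

theorem eFun_one_apply {G : Type*} [Group G] [Finite G] (K : Type*) [Field K] {p : ℕ}
    (hp : p.Prime) (g : G) : eFun p K 1 g = if IsPElement p g then 1 else 0 := by
  simp only [eFun, isConj_one_right, pPrimePart_eq_one_iff hp]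

namespace DihedralGroup

/-- The morphism of dihedral groups induced by a morphism of their rotation groups. -/
def mapHom {a b : ℕ} (α : ZMod a →+ ZMod b) : DihedralGroup a →* DihedralGroup b where
  toFun
    | r i => r (α i)
    | sr i => sr (α i)
  map_one' := congrArg r (map_zero α)
  map_mul' := by rintro (i | i) (j | j) <;> simp

@[simp]
theorem mapHom_r {a b : ℕ} (α : ZMod a →+ ZMod b) (i : ZMod a) : mapHom α (r i) = r (α i) := rfl

@[simp]
theorem mapHom_sr {a b : ℕ} (α : ZMod a →+ ZMod b) (i : ZMod a) : mapHom α (sr i) = sr (α i) := rfl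

end DihedralGroup

theorem ZMod.exists_two_part_retraction (k m : ℕ) :
    ∃ (α : ZMod (2 ^ k) →+ ZMod (2 ^ k * (2 * m + 1)))
      (β : ZMod (2 ^ k * (2 * m + 1)) →+ ZMod (2 ^ k)), (∀ i, β (α i) = i) ∧
      (∀ i : ZMod (2 ^ k * (2 * m + 1)), i * (2 ^ k : ℕ) = 0 → α (β i) = i) ∧
      ∀ i, ∃ j, α (β i) = i + (j + j) := by
  set q := 2 ^ k
  have hcop : Nat.Coprime (2 * q) (2 * m + 1) := by
    rw [← pow_succ']
    exact Nat.Coprime.pow_left _ (by simp)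
  obtain ⟨v, hv1, hv2⟩ := Nat.chineseRemainder hcop 1 0
  obtain ⟨w, hw⟩ : ((2 * q : ℕ) : ℤ) ∣ v - 1 := (Nat.modEq_iff_dvd.mp hv1.symm)
  have hv : q * (2 * m + 1) ∣ q * v := Nat.mul_dvd_mul_left q ((Nat.modEq_zero_iff_dvd).mp hv2)
  have hw' : (v : ℤ) = 1 + 2 * q * w := by push_cast at hw; linarith
  let α : ZMod q →+ ZMod (q * (2 * m + 1)) :=
    ZMod.lift q ⟨zmultiplesHom _ (v : ZMod (q * (2 * m + 1))), by
      have := (ZMod.natCast_eq_zero_iff _ _).mpr hv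
      simpa using this⟩
  let β : ZMod (q * (2 * m + 1)) →+ ZMod q :=
    (ZMod.castHom (dvd_mul_right q _) (ZMod q)).toAddMonoidHom
  have hα : ∀ z : ℤ, α z = z * (v : ZMod (q * (2 * m + 1))) := fun z => by
    simp [α]
  have hβ : ∀ z : ℤ, β z = z := fun z => by
    simp [β]
  have hvq : (v : ZMod q) = 1 := by
    have := congrArg (Int.cast (R := ZMod q)) hw'
    simpa using this
  have hvN : (v : ZMod (q * (2 * m + 1))) = 1 + 2 * q * w := by
    have := congrArg (Int.cast (R := ZMod (q * (2 * m + 1)))) hw'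
    simpa using this
  refine ⟨α, β, fun i => ?_, fun i hi => ?_, fun i => ?_⟩
  · obtain ⟨z, rfl⟩ := ZMod.intCast_surjective i
    have := hβ (z * v)
    push_cast at this
    rw [hα, this, hvq, mul_one]
  · obtain ⟨z, rfl⟩ := ZMod.intCast_surjective i
    rw [hβ, hα, hvN]
    linear_combination 2 * w * hi
  · obtain ⟨z, rfl⟩ := ZMod.intCast_surjective i
    rw [hβ, hα, hvN]
    exact ⟨q * w * z, by ring⟩

namespace DihedralGroup

theorem exists_two_retraction (K : Type) [Field K] (k m : ℕ) :
    ∃ (φ : DihedralGroup (2 ^ k) →* DihedralGroup (2 ^ k * (2 * m + 1)))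
      (π : DihedralGroup (2 ^ k * (2 * m + 1)) →* DihedralGroup (2 ^ k)), (∀ g, π (φ g) = g) ∧
      (∀ g, eFun 2 K 1 (φ g) = 1) ∧
      ∀ f : DihedralGroup (2 ^ k * (2 * m + 1)) → K, (∀ x y, f (y * x * y⁻¹) = f x) →
        (∀ g, f (φ g) = 0) → ∀ x, eFun 2 K 1 x * f x = 0 := by
  obtain ⟨α, β, h1, h2, h3⟩ := ZMod.exists_two_part_retraction k m
  refine ⟨mapHom α, mapHom β, ?_, ?_, ?_⟩
  · rintro (i | i) <;> simp [h1]
  · intro g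
    rw [eFun_one_apply K Nat.prime_two, if_pos]
    have h4 := (orderOf_map_dvd (mapHom α) g).trans (orderOf_dvd_natCard g)
    rw [nat_card, ← pow_succ'] at h4
    obtain ⟨a, -, ha⟩ := (Nat.dvd_prime_pow Nat.prime_two).mp h4
    exact ⟨a, ha⟩
  · intro f hf h0 x
    rcases x with i | i
    · rw [eFun_one_apply K Nat.prime_two]
      split_ifs with h
      · obtain ⟨a, ha⟩ := h
        have h4 : orderOf (r i) ∣ 2 ^ k * (2 * m + 1) := by
          rw [orderOf_dvd_iff_pow_eq_one, r_pow, ZMod.natCast_self, mul_zero, r_zero]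
        have h5 : orderOf (r i) ∣ 2 ^ k := by
          refine Nat.Coprime.dvd_of_dvd_mul_right ?_ h4
          rw [ha]
          exact Nat.Coprime.pow_left _ (by simp)
        rw [orderOf_dvd_iff_pow_eq_one, r_pow, one_def, r.injEq] at h5
        have := h0 (r (β i))
        rw [mapHom_r, h2 i h5] at this
        rw [this, mul_zero]
      · rw [zero_mul]
    · obtain ⟨j, hj⟩ := h3 i
      have h4 := h0 (sr (β i))
      have h5 := hf (sr i) (r (-j))
      rw [mapHom_sr, hj] at h4
      rw [inv_r, neg_neg, r_mul_sr, sr_mul_r, sub_neg_eq_add, add_assoc, h4] at h5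
      rw [← h5, mul_zero]

variable {K : Type} [Field K] [CharZero K] {q : ℕ} [NeZero q]

theorem charAvg_one_signChar_mul (i j : Fin 2) :
    charAvg ((![1, ⇑(signChar K q)] : Fin 2 → DihedralGroup q → K) i *
      (![1, ⇑(signChar K q)] : Fin 2 → DihedralGroup q → K) j) = if i = j then (1 : K) else 0 := by
  fin_cases i <;> fin_cases j <;> simp [charAvg_one, charAvg_signChar, signChar_mul_self]

theorem eq_sum_one_signChar (hq : q = 1) (f : DihedralGroup q → K) :
    f = ∑ i, charAvg (f * (![1, ⇑(signChar K q)] : Fin 2 → DihedralGroup q → K) i) •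
      (![1, ⇑(signChar K q)] : Fin 2 → DihedralGroup q → K) i := by
  subst hq
  funext g
  rcases g with j | j
  · simp [charAvg_eq]
    ring_nf
    exact congrArg (fun x => f (r x)) (Subsingleton.elim _ _)
  · simp [charAvg_eq]
    ring_nf
    exact congrArg (fun x => f (sr x)) (Subsingleton.elim _ _)

end DihedralGroup

section scalars

variable {k A : Type*} [CommRing A] {ι : Type*} [Fintype ι] {v : ι → A}

theorem linearIndependent_of_ringHom [Field k] (φ : k →+* A)
    (li : ∀ c : ι → k, ∑ i, φ (c i) * v i = 0 → ∀ j, c j = 0) :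
    letI := φ.toAlgebra; LinearIndependent k v := by
  let := φ.toAlgebra
  exact Fintype.linearIndependent_iff.mpr fun c hc => li c (hc ▸ rfl)

theorem top_le_span_of_ringHom [Field k] (φ : k →+* A)
    (sp : ∀ y, ∃ c : ι → k, y = ∑ i, φ (c i) * v i) :
    letI := φ.toAlgebra; ⊤ ≤ Submodule.span k (Set.range v) := by
  let := φ.toAlgebra
  intro y _
  obtain ⟨c, hc⟩ := sp y
  exact (Submodule.mem_span_range_iff_exists_fun k).mpr ⟨c, by rw [hc]; rfl⟩

end scalars

theorem DihedralGroup.irrChar_mem_charSet {K : Type} [Field K] {q : ℕ} [NeZero q]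
    (ψ : AddChar (ZMod q) K) (M : ℕ) (hM : (M + M : ZMod q) = 0) (i : Fin 4 ⊕ Fin (M - 1)) :
    irrChar ψ M hM i ∈ charSet K (DihedralGroup q) := by
  have ha : ⇑(signChar K q) ∈ charSet K (DihedralGroup q) := monoidHom_mem_charSet _
  have hb : ⇑(twistChar ψ M hM) ∈ charSet K (DihedralGroup q) := monoidHom_mem_charSet _
  rcases i with i | i
  · fin_cases i
    · exact one_mem_charSet
    · exact ha
    · exact hb
    · exact mul_mem_charSet ha hb
  · exact rotChar_mem_charSet ψ _

section dihedral

variable {𝒪 K : Type} [CommRing 𝒪] [Field K] [Algebra 𝒪 K] {𝔭 : Ideal 𝒪} [𝔭.IsMaximal]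

theorem two_eq_zero_in_block (hp : (2 : 𝒪) ∈ 𝔭) {G : Type} [Group G]
    (e : locCharRing 𝒪 K 𝔭 G) : (2 : blockAlg 𝒪 K 𝔭 G e) = 0 := by
  have h : (2 : 𝒪 ⧸ 𝔭) = 0 := Ideal.Quotient.eq_zero_iff_mem.mpr hp
  rw [← map_ofNat (blockScalars 𝒪 K 𝔭 G e) 2, h, map_zero]

open DihedralGroup

variable [FaithfulSMul 𝒪 K] [CharZero K]

theorem dihedral_block_basis (k m : ℕ)
    (he : eFun 2 K (1 : DihedralGroup (2 ^ k * (2 * m + 1))) ∈ locCharRing 𝒪 K 𝔭 _) :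
    ∃ Ψ : charRing K (DihedralGroup (2 ^ k)) →+* blockAlg 𝒪 K 𝔭 _ ⟨_, he⟩,
      ∀ {ι : Type} [Fintype ι] (ψ : ι → charRing K (DihedralGroup (2 ^ k))),
      (∀ i, (ψ i).1 ∈ charSet K (DihedralGroup (2 ^ k))) →
      (∀ i j, charAvg ((ψ i).1 * (ψ j).1) = if i = j then (1 : K) else 0) →
      (∀ f : DihedralGroup (2 ^ k) → K, (∀ x y, f (y * x * y⁻¹) = f x) →
        f = ∑ i, charAvg (f * (ψ i).1) • (ψ i).1) →
      letI := Ideal.Quotient.field 𝔭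
      letI := (blockScalars 𝒪 K 𝔭 _ ⟨_, he⟩).toAlgebra
      LinearIndependent (𝒪 ⧸ 𝔭) (fun i => Ψ (ψ i)) ∧
        ⊤ ≤ Submodule.span (𝒪 ⧸ 𝔭) (Set.range fun i => Ψ (ψ i)) := by
  obtain ⟨φ, π, hπφ, heφ, hvan⟩ := exists_two_retraction K k m
  refine ⟨(Ideal.Quotient.mk (blockIdeal 𝒪 K 𝔭 _ ⟨_, he⟩)).comp (charInfl 𝒪 𝔭 π),
    fun ψ hψ horth hcompl => ?_⟩
  let := Ideal.Quotient.field 𝔭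
  exact ⟨linearIndependent_of_ringHom (blockScalars 𝒪 K 𝔭 _ ⟨_, he⟩)
      (block_independent (e := ⟨_, he⟩) hπφ heφ hψ horth),
    top_le_span_of_ringHom (blockScalars 𝒪 K 𝔭 _ ⟨_, he⟩)
      (block_spanned (e := ⟨_, he⟩) hπφ hvan hψ hcompl)⟩

theorem dihedral_block_invariants_zero (hp : (2 : 𝒪) ∈ 𝔭) (k m : ℕ) (hk : k = 0)
    (he : eFun 2 K (1 : DihedralGroup (2 ^ k * (2 * m + 1))) ∈ locCharRing 𝒪 K 𝔭 _) :
    loewyLength (blockAlg 𝒪 K 𝔭 _ ⟨_, he⟩) = 2 ∧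
      extDim (𝒪 ⧸ 𝔭) (blockScalars 𝒪 K 𝔭 _ ⟨_, he⟩) = 1 := by
  obtain ⟨Ψ, hΨ⟩ := dihedral_block_basis (𝔭 := 𝔭) k m he
  have hA : ⇑(signChar K (2 ^ k)) ∈ charSet K (DihedralGroup (2 ^ k)) := monoidHom_mem_charSet _
  let A : charRing K (DihedralGroup (2 ^ k)) := ⟨_, Subring.subset_closure hA⟩
  have hv : ∀ i, ((![1, A] : Fin 2 → charRing K (DihedralGroup (2 ^ k))) i).1 =
      (![1, ⇑(signChar K (2 ^ k))] : Fin 2 → DihedralGroup (2 ^ k) → K) i := by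
    intro i
    fin_cases i <;> rfl
  let := Ideal.Quotient.field 𝔭
  obtain ⟨li, sp⟩ := hΨ ![1, A]
    (by
      intro i
      fin_cases i
      · exact one_mem_charSet
      · exact hA)
    (by
      simp only [hv]
      exact fun i j => (charAvg_one_signChar_mul i j).trans (by congr))
    (by
      simp only [hv]
      exact fun f _ => eq_sum_one_signChar (K := K) (q := 2 ^ k) (by rw [hk, pow_zero]) f)
  have hw : (fun i => Ψ ((![1, A] : Fin 2 → charRing K (DihedralGroup (2 ^ k))) i)) =
      ![1, Ψ A] := by
    funext i
    fin_cases i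
    · exact map_one Ψ
    · rfl
  have haa : Ψ A * Ψ A = 1 := by
    rw [← map_mul, ← map_one Ψ]
    exact congrArg Ψ (Subtype.ext signChar_mul_self)
  rw [hw] at li sp
  let := (blockScalars 𝒪 K 𝔭 _ ⟨_, he⟩).toAlgebra
  exact involution_algebra_invariants (two_eq_zero_in_block hp _) haa li sp

theorem natCast_add_natCast_two_pow_sub_one {k : ℕ} (hk : 0 < k) :
    (((2 ^ (k - 1) : ℕ) : ZMod (2 ^ k)) + ((2 ^ (k - 1) : ℕ) : ZMod (2 ^ k))) = 0 := by
  rw [← Nat.cast_add, ← two_mul, ← pow_succ', Nat.sub_add_cancel hk, ZMod.natCast_self]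

theorem dihedral_block_generators {k : ℕ} (hk : 0 < k) (m : ℕ) {ζ : K}
    (hζ : IsPrimitiveRoot ζ (Nat.card (DihedralGroup (2 ^ k * (2 * m + 1)))))
    (he : eFun 2 K (1 : DihedralGroup (2 ^ k * (2 * m + 1))) ∈ locCharRing 𝒪 K 𝔭 _) :
    letI := Ideal.Quotient.field 𝔭
    letI := (blockScalars 𝒪 K 𝔭 _ ⟨_, he⟩).toAlgebra
    ∃ (a b : blockAlg 𝒪 K 𝔭 _ ⟨_, he⟩) (χ : ℤ → blockAlg 𝒪 K 𝔭 _ ⟨_, he⟩),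
      a * a = 1 ∧ b * b = 1 ∧ (∀ i j, χ i * χ j = χ (i + j) + χ (i - j)) ∧
      (∀ i, χ (-i) = χ i) ∧ χ 0 = 1 + a ∧ (∀ i, a * χ i = χ i) ∧
      (∀ i, b * χ i = χ (i + (2 ^ (k - 1) : ℕ))) ∧
      LinearIndependent (𝒪 ⧸ 𝔭) (Sum.elim ![1, a, b, a * b]
        fun i : Fin (2 ^ (k - 1) - 1) => χ ((i : ℕ) + 1)) ∧
      ⊤ ≤ Submodule.span (𝒪 ⧸ 𝔭) (Set.range (Sum.elim ![1, a, b, a * b]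
        fun i : Fin (2 ^ (k - 1) - 1) => χ ((i : ℕ) + 1))) := by
  obtain ⟨Ψ, hΨ⟩ := dihedral_block_basis (𝔭 := 𝔭) k m he
  have hq : 2 ^ k = 2 * 2 ^ (k - 1) := by rw [← pow_succ', Nat.sub_add_cancel hk]
  have hM := natCast_add_natCast_two_pow_sub_one hk
  have hξ := hζ.pow (a := 2 * (2 * m + 1)) (b := 2 ^ k) Nat.card_pos (by
    rw [nat_card]
    ring)
  have hψ := AddChar.zmodChar_primitive_of_primitive_root (2 ^ k) hξ
  set ψ := AddChar.zmodChar (2 ^ k) ((IsPrimitiveRoot.iff_def _ (2 ^ k)).mp hξ).left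
  let A : charRing K (DihedralGroup (2 ^ k)) :=
    ⟨signChar K (2 ^ k), Subring.subset_closure (monoidHom_mem_charSet _)⟩
  let B : charRing K (DihedralGroup (2 ^ k)) :=
    ⟨twistChar ψ _ hM, Subring.subset_closure (monoidHom_mem_charSet _)⟩
  let X : ℤ → charRing K (DihedralGroup (2 ^ k)) := fun t =>
    ⟨rotChar ψ (t : ZMod (2 ^ k)), Subring.subset_closure (rotChar_mem_charSet ψ _)⟩
  let F : Fin 4 ⊕ Fin (2 ^ (k - 1) - 1) → charRing K (DihedralGroup (2 ^ k)) :=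
    Sum.elim ![1, A, B, A * B] fun i => X ((i : ℕ) + 1)
  have hF : ∀ i, (F i).1 = irrChar ψ _ hM i := by
    rintro (i | i)
    · fin_cases i <;> rfl
    · rfl
  have hF' : (fun i => Ψ (F i)) = Sum.elim ![1, Ψ A, Ψ B, Ψ A * Ψ B]
      fun i : Fin (2 ^ (k - 1) - 1) => Ψ (X ((i : ℕ) + 1)) := by
    funext i
    rcases i with i | i
    · fin_cases i
      · exact map_one Ψ
      · rfl
      · rfl
      · exact map_mul Ψ A B
    · rfl
  have h0 : 0 < 2 ^ (k - 1) := by positivity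
  obtain ⟨li, sp⟩ := hΨ F (fun i => hF i ▸ irrChar_mem_charSet ψ _ hM i)
    (by
      simp only [hF]
      exact fun i j => (charAvg_irrChar_mul hψ h0 hq hM i j).trans (by congr))
    (by
      simp only [hF]
      exact fun f hf => eq_sum_irrChar hψ h0 hq hM hf)
  rw [hF'] at li sp
  refine ⟨Ψ A, Ψ B, fun i => Ψ (X i), ?_, ?_, fun i j => ?_, fun i => ?_, ?_, fun i => ?_,
    fun i => ?_, li, sp⟩
  · rw [← map_mul, ← map_one Ψ]
    exact congrArg Ψ (Subtype.ext signChar_mul_self)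
  · rw [← map_mul, ← map_one Ψ]
    exact congrArg Ψ (Subtype.ext (twistChar_mul_self ψ _ hM))
  · rw [← map_mul, ← map_add]
    refine congrArg Ψ (Subtype.ext ((rotChar_mul ψ i j).trans ?_))
    simp [X]
  · refine congrArg Ψ (Subtype.ext ?_)
    simp [X, rotChar_neg]
  · rw [← map_one Ψ, ← map_add]
    refine congrArg Ψ (Subtype.ext ?_)
    simp [X, A, rotChar_zero]
  · rw [← map_mul]
    exact congrArg Ψ (Subtype.ext (signChar_mul_rotChar ψ _))
  · rw [← map_mul]
    refine congrArg Ψ (Subtype.ext ((twistChar_mul_rotChar ψ _ hM _).trans ?_))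
    simp [X]

theorem dihedral_block_invariants_one (hp : (2 : 𝒪) ∈ 𝔭) {k : ℕ} (hk : k = 1) (m : ℕ) {ζ : K}
    (hζ : IsPrimitiveRoot ζ (Nat.card (DihedralGroup (2 ^ k * (2 * m + 1)))))
    (he : eFun 2 K (1 : DihedralGroup (2 ^ k * (2 * m + 1))) ∈ locCharRing 𝒪 K 𝔭 _) :
    loewyLength (blockAlg 𝒪 K 𝔭 _ ⟨_, he⟩) = 3 ∧
      extDim (𝒪 ⧸ 𝔭) (blockScalars 𝒪 K 𝔭 _ ⟨_, he⟩) = 2 := by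
  let := Ideal.Quotient.field 𝔭
  let := (blockScalars 𝒪 K 𝔭 _ ⟨_, he⟩).toAlgebra
  obtain ⟨a, b, χ, ha, hb, -, -, -, -, -, li, sp⟩ :=
    dihedral_block_generators (𝔭 := 𝔭) (hk ▸ one_pos) m hζ he
  have : IsEmpty (Fin (2 ^ (k - 1) - 1)) := by
    rw [hk]
    exact Fin.isEmpty
  have li' := li.comp Sum.inl Sum.inl_injective
  rw [Sum.elim_comp_inl] at li'
  rw [Set.Sum.elim_range, Set.range_eq_empty (fun i : Fin (2 ^ (k - 1) - 1) => χ ((i : ℕ) + 1)),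
    Set.union_empty] at sp
  exact klein_four_algebra_invariants (two_eq_zero_in_block hp _) ha hb li' sp

theorem dihedral_block_invariants_of_two_le (hp : (2 : 𝒪) ∈ 𝔭) {k : ℕ} (hk : 2 ≤ k) (m : ℕ)
    {ζ : K} (hζ : IsPrimitiveRoot ζ (Nat.card (DihedralGroup (2 ^ k * (2 * m + 1)))))
    (he : eFun 2 K (1 : DihedralGroup (2 ^ k * (2 * m + 1))) ∈ locCharRing 𝒪 K 𝔭 _) :
    loewyLength (blockAlg 𝒪 K 𝔭 _ ⟨_, he⟩) = 2 ^ (k - 1) + 1 ∧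
      extDim (𝒪 ⧸ 𝔭) (blockScalars 𝒪 K 𝔭 _ ⟨_, he⟩) = 3 := by
  let := Ideal.Quotient.field 𝔭
  let := (blockScalars 𝒪 K 𝔭 _ ⟨_, he⟩).toAlgebra
  obtain ⟨a, b, χ, ha, hb, hmul, hneg, h0, haχ, hbχ, li, sp⟩ :=
    dihedral_block_generators (𝔭 := 𝔭) (by omega) m hζ he
  have h2 : (2 : blockAlg 𝒪 K 𝔭 _ ⟨_, he⟩) = 0 := two_eq_zero_in_block hp _
  have hM : 2 ^ (k - 1) = 2 ^ (k - 2 + 1) := congrArg _ (by omega)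
  exact dihedral_algebra_invariants (M := 2 ^ (k - 1)) h2 hM hb hmul hneg h0 haχ hbχ li sp

end dihedral

variable {𝒪 : Type} [CommRing 𝒪] [IsDomain 𝒪] [IsDedekindDomain 𝒪] [CharZero 𝒪]
variable {K : Type} [Field K] [Algebra 𝒪 K] [IsFractionRing 𝒪 K]
variable {𝔭 : Ideal 𝒪} [𝔭.IsMaximal]

set_option maxHeartbeats 2000000 in
set_option synthInstance.maxHeartbeats 1000000 in
/-- Let `G = D_{2^n(2m+1)}` be the dihedral group of order `2^n(2m+1)`
(`n ≥ 1`, `m ≥ 0`) and `p = 2`.  Then `ℓ_2(G,1) = 2, 3, 2^{n-2}+1` according as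
`n = 1`, `n = 2`, `n ≥ 3`, and `ext_2^1(G,1) = 1, 2, 3` accordingly. -/
theorem dihedral_principal_block_invariants
    (hp : (2 : 𝒪) ∈ 𝔭)
    (n m : ℕ) (hn : 1 ≤ n)
    (ζ : K) (hζ : IsPrimitiveRoot ζ (Nat.card (DihedralGroup (2 ^ (n - 1) * (2 * m + 1)))))
    (he1 : eFun 2 K (1 : DihedralGroup (2 ^ (n - 1) * (2 * m + 1))) ∈
      locCharRing 𝒪 K 𝔭 (DihedralGroup (2 ^ (n - 1) * (2 * m + 1)))) :
    ((n = 1 → loewyLength (blockAlg 𝒪 K 𝔭 (DihedralGroup (2 ^ (n - 1) * (2 * m + 1)))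
        ⟨eFun 2 K 1, he1⟩) = 2) ∧
     (n = 2 → loewyLength (blockAlg 𝒪 K 𝔭 (DihedralGroup (2 ^ (n - 1) * (2 * m + 1)))
        ⟨eFun 2 K 1, he1⟩) = 3) ∧
     (3 ≤ n → loewyLength (blockAlg 𝒪 K 𝔭 (DihedralGroup (2 ^ (n - 1) * (2 * m + 1)))
        ⟨eFun 2 K 1, he1⟩) = 2 ^ (n - 2) + 1)) ∧
    ((n = 1 → extDim (𝒪 ⧸ 𝔭) (blockScalars 𝒪 K 𝔭 (DihedralGroup (2 ^ (n - 1) * (2 * m + 1)))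
        ⟨eFun 2 K 1, he1⟩) = 1) ∧
     (n = 2 → extDim (𝒪 ⧸ 𝔭) (blockScalars 𝒪 K 𝔭 (DihedralGroup (2 ^ (n - 1) * (2 * m + 1)))
        ⟨eFun 2 K 1, he1⟩) = 2) ∧
     (3 ≤ n → extDim (𝒪 ⧸ 𝔭) (blockScalars 𝒪 K 𝔭 (DihedralGroup (2 ^ (n - 1) * (2 * m + 1)))
        ⟨eFun 2 K 1, he1⟩) = 3)) := by
  have : FaithfulSMul 𝒪 K :=
    (faithfulSMul_iff_algebraMap_injective 𝒪 K).mpr (IsFractionRing.injective 𝒪 K)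
  have : CharZero K := charZero_of_injective_algebraMap (IsFractionRing.injective 𝒪 K)
  have h3 (h : 3 ≤ n) := dihedral_block_invariants_of_two_le hp (k := n - 1) (by omega) m hζ he1
  rw [Nat.sub_sub] at h3
  exact ⟨⟨fun h => (dihedral_block_invariants_zero hp (n - 1) m (by omega) he1).1,
      fun h => (dihedral_block_invariants_one hp (by omega) m hζ he1).1, fun h => (h3 h).1⟩,
    fun h => (dihedral_block_invariants_zero hp (n - 1) m (by omega) he1).2,
    fun h => (dihedral_block_invariants_one hp (by omega) m hζ he1).2, fun h => (h3 h).2⟩
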